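/- arXiv:1212.6894 — 6 statements merged into one kernel-verified Lean document; each statement's English description precedes it below -/
import Mathlib

section
/- Let k be a field of characteristic zero, (R,𝔪) a Noetherian local k-algebra, m ≤ n, and A ∈ Mat(m,n;𝔪). Then A is finitely-G_{lr}-determined if and only if A is finitely-G_r-determined. -/
open IsLocalRing

namespace Matrix

variable {R : Type*} [CommRing R] {m n : Type*} [Fintype m] [DecidableEq m]

/-- The ideal generated by the maximal minors of a matrix with row index `m`. -/
def maximalMinorsIdeal (A : Matrix m n R) : Ideal R :=
  Ideal.span (Set.range fun f : m → n => (A.submatrix id f).det)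

variable [Fintype n]

/-- The determinant of `A * X` is a combination of the maximal minors of `A`. -/
theorem det_mul_mem_maximalMinorsIdeal (A : Matrix m n R) (X : Matrix n m R) :
    (A * X).det ∈ A.maximalMinorsIdeal := by
  classical
  have h : (A * X).det = ∑ f : m → n, (∏ j, X (f j) j) * (A.submatrix id f).det := by
    rw [← det_transpose]
    have h₁ : (A * X)ᵀ = fun j => ∑ i : n, X i j • Aᵀ i := by
      ext j l
      simp [mul_apply, mul_comm]
    have h₂ := (detRowAlternating (R := R) (n := m)).toMultilinearMap.map_sum
      (fun (j : m) (i : n) => X i j • Aᵀ i)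
    rw [h₁]
    refine h₂.trans (Finset.sum_congr rfl fun f _ => ?_)
    rw [MultilinearMap.map_smul_univ, smul_eq_mul, ← det_transpose (A.submatrix id f)]
    rfl
  rw [h]
  exact sum_mem fun f _ => Ideal.mul_mem_left _ _ (Ideal.subset_span ⟨f, rfl⟩)

theorem exists_mul_eq_smul_one_of_mem_maximalMinorsIdeal [DecidableEq n] (A : Matrix m n R)
    {b : R} (hb : b ∈ A.maximalMinorsIdeal) : ∃ C : Matrix n m R, A * C = b • 1 := by
  induction hb using Submodule.span_induction with
  | mem x hx =>
    obtain ⟨f, rfl⟩ := hx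
    refine ⟨(1 : Matrix n n R).submatrix id f * (A.submatrix id f).adjugate, ?_⟩
    have h : A * (1 : Matrix n n R).submatrix id f = A.submatrix id f := by
      ext i j
      simp [mul_apply, one_apply]
    rw [← Matrix.mul_assoc, h, mul_adjugate]
  | zero => exact ⟨0, by simp⟩
  | add x y _ _ hx hy =>
    obtain ⟨C, hC⟩ := hx
    obtain ⟨D, hD⟩ := hy
    exact ⟨C + D, by rw [Matrix.mul_add, hC, hD, add_smul]⟩
  | smul a x _ hx =>
    obtain ⟨C, hC⟩ := hx
    exact ⟨a • C, by rw [Matrix.mul_smul, hC, smul_assoc]⟩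

theorem exists_mulVec_eq_single_of_mem_maximalMinorsIdeal_mul (A : Matrix m n R) {J : Ideal R}
    {b : R} (hb : b ∈ A.maximalMinorsIdeal * J) (i : m) :
    ∃ w : n → R, (∀ j, w j ∈ J) ∧ A *ᵥ w = Pi.single i b := by
  classical
  induction hb using Submodule.mul_induction_on' with
  | mem_mul_mem x hx y hy =>
    obtain ⟨C, hC⟩ := A.exists_mul_eq_smul_one_of_mem_maximalMinorsIdeal hx
    refine ⟨C *ᵥ Pi.single i y, fun j => ?_, ?_⟩
    · simpa using J.mul_mem_left _ hy
    · rw [mulVec_mulVec, hC, smul_mulVec, one_mulVec, ← Pi.single_smul, smul_eq_mul]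
  | add x _ y _ hx hy =>
    obtain ⟨v, hv, hv'⟩ := hx
    obtain ⟨w, hw, hw'⟩ := hy
    exact ⟨v + w, fun j => J.add_mem (hv j) (hw j), by rw [mulVec_add, hv', hw', Pi.single_add]⟩

theorem exists_mul_eq_of_forall_mem_maximalMinorsIdeal_mul {l : Type*} (A : Matrix m n R)
    {J : Ideal R} {B : Matrix m l R} (hB : ∀ i j, B i j ∈ A.maximalMinorsIdeal * J) :
    ∃ W : Matrix n l R, (∀ i j, W i j ∈ J) ∧ A * W = B := by
  choose w hw hwB using fun i j =>
    A.exists_mulVec_eq_single_of_mem_maximalMinorsIdeal_mul (hB i j) i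
  refine ⟨of fun a j => ∑ i, w i j a, fun a j => sum_mem fun i _ => hw i j a, ?_⟩
  ext i j
  have h : (A *ᵥ ∑ i', w i' j) i = B i j := by
    rw [mulVec_sum, Finset.sum_apply, Finset.sum_congr rfl fun i' _ => congrFun (hwB i' j) i]
    simp [Pi.single_apply]
  rw [← h]
  simp [mul_apply, mulVec, dotProduct]

/-- A matrix congruent to `1` modulo the maximal ideal of a local ring is invertible. -/
theorem isUnit_one_add_of_forall_mem_maximalIdeal [IsLocalRing R] {W : Matrix m m R}
    (hW : ∀ i j, W i j ∈ maximalIdeal R) : IsUnit (1 + W) := by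
  rw [isUnit_iff_isUnit_det, ← isUnit_map_iff (residue R), RingHom.map_det]
  have h : (residue R).mapMatrix W = 0 := by
    ext i j
    simpa using hW i j
  simp [map_add, h]

/-- Over a domain of characteristic zero, adding a suitable natural multiple of a nonzero scalar
makes a square matrix nonsingular. -/
theorem exists_det_add_natCast_mul_smul_one_ne_zero [IsDomain R] [CharZero R] (M : Matrix m m R)
    {x : R} (hx : x ≠ 0) : ∃ c : ℕ, (M + (c * x) • (1 : Matrix m m R)).det ≠ 0 := by
  by_contra! h
  refine (-M).charpoly_monic.ne_zero (Polynomial.eq_zero_of_infinite_isRoot _ ?_)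
  have hinj : Function.Injective fun c : ℕ => (c : R) * x := fun a b hab =>
    Nat.cast_injective (mul_right_cancel₀ hx hab)
  refine (Set.infinite_range_of_injective hinj).mono ?_
  rintro _ ⟨c, rfl⟩
  rw [Set.mem_ofPred_eq, Polynomial.IsRoot, eval_charpoly, ← h c, sub_neg_eq_add, add_comm,
    scalar_apply, smul_one_eq_diagonal]

end Matrix

open Matrix in
/-- If all small perturbations of `A` are left-right equivalent to `A`, then the maximal minors
of `A` generate an ideal containing the maximal ideal up to radical. -/
theorem maximalIdeal_le_radical_maximalMinorsIdeal {k R : Type*} [Field k] [CharZero k]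
    [CommRing R] [Algebra k R] [IsLocalRing R] {m n : ℕ} (hmn : m ≤ n)
    (A : Matrix (Fin m) (Fin n) R) (N : ℕ)
    (h : ∀ B : Matrix (Fin m) (Fin n) R, (∀ i j, B i j ∈ (maximalIdeal R) ^ N) →
      ∃ (U : Matrix (Fin m) (Fin m) R) (V : Matrix (Fin n) (Fin n) R),
        IsUnit U ∧ IsUnit V ∧ A + B = U * A * V) :
    maximalIdeal R ≤ A.maximalMinorsIdeal.radical := by
  rw [Ideal.radical_eq_sInf]
  refine le_sInf ?_
  rintro p ⟨hAp, hp⟩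
  by_contra hle
  obtain ⟨x, hx, hxp⟩ := SetLike.not_le_iff_exists.mp (mt hp.le_of_pow_le hle : ¬ _ ^ N ≤ p)
  have : CharZero (R ⧸ p) := charZero_of_injective_algebraMap (algebraMap k (R ⧸ p)).injective
  let e : Fin m → Fin n := Fin.castLE hmn
  obtain ⟨c, hc⟩ := ((Ideal.Quotient.mk p).mapMatrix
    (A.submatrix id e)).exists_det_add_natCast_mul_smul_one_ne_zero
      (mt Ideal.Quotient.eq_zero_iff_mem.mp hxp)
  let B : Matrix (Fin m) (Fin n) R := of fun i j => if j = e i then c * x else 0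
  obtain ⟨U, V, -, -, hUV⟩ := h B fun i j => by
    simp only [B, of_apply]
    split_ifs
    exacts [Ideal.mul_mem_left _ _ hx, zero_mem _]
  have hdet : ((A + B).submatrix id e).det ∈ p := by
    have hsub : (A + B).submatrix id e = U * (A * V.submatrix id e) := by
      rw [hUV, Matrix.mul_assoc]
      rfl
    rw [hsub, det_mul]
    exact hAp (Ideal.mul_mem_left _ _ (A.det_mul_mem_maximalMinorsIdeal _))
  refine hc ?_
  rw [← Ideal.Quotient.eq_zero_iff_mem, RingHom.map_det] at hdet
  rw [← hdet]
  congr 1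
  ext i j
  have he : e j = e i ↔ i = j := by simp [e, Fin.ext_iff, eq_comm]
  by_cases hij : i = j <;> simp [B, he, one_apply, hij]

/-- For `m ≤ n` and `A ∈ Mat(m,n;𝔪)`, `A` is finitely-`G_{lr}`-determined
iff it is finitely-`G_r`-determined. -/
theorem finite_Glr_determined_iff_finite_Gr_determined
    {k R : Type*} [Field k] [CharZero k] [CommRing R] [Algebra k R]
    [IsNoetherianRing R] [IsLocalRing R]
    {m n : ℕ} (hmn : m ≤ n)
    (A : Matrix (Fin m) (Fin n) R)
    (hA : ∀ i j, A i j ∈ maximalIdeal R) :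
    (∃ k₀ : ℕ, ∀ B : Matrix (Fin m) (Fin n) R,
        (∀ i j, B i j ∈ (maximalIdeal R) ^ (k₀ + 1)) →
        ∃ (U : Matrix (Fin m) (Fin m) R) (V : Matrix (Fin n) (Fin n) R),
          IsUnit U ∧ IsUnit V ∧ A + B = U * A * V) ↔
    (∃ k₀ : ℕ, ∀ B : Matrix (Fin m) (Fin n) R,
        (∀ i j, B i j ∈ (maximalIdeal R) ^ (k₀ + 1)) →
        ∃ V : Matrix (Fin n) (Fin n) R, IsUnit V ∧ A + B = A * V) := by
  constructor
  · rintro ⟨k₀, h⟩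
    obtain ⟨N, hN⟩ := Ideal.exists_pow_le_of_le_radical_of_fg
      (maximalIdeal_le_radical_maximalMinorsIdeal (k := k) hmn A (k₀ + 1) h)
      (IsNoetherian.noetherian _)
    refine ⟨N, fun B hB => ?_⟩
    obtain ⟨W, hW, rfl⟩ := A.exists_mul_eq_of_forall_mem_maximalMinorsIdeal_mul
      fun i j => Ideal.mul_mono_left hN (pow_succ (maximalIdeal R) N ▸ hB i j)
    exact ⟨1 + W, Matrix.isUnit_one_add_of_forall_mem_maximalIdeal hW,
      by rw [Matrix.mul_add, Matrix.mul_one]⟩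
  · rintro ⟨k₀, h⟩
    refine ⟨k₀, fun B hB => ?_⟩
    obtain ⟨V, hV, hAB⟩ := h B hB
    exact ⟨1, V, isUnit_one, hV, by rw [hAB, Matrix.one_mul]⟩
end

section
/- Let k be a field of characteristic zero, (R,𝔪) a Noetherian local k-algebra, m ≤ n, and A ∈ Mat(m,n;𝔪). Then A is finitely-G_r-determined if and only if there exists N ∈ ℕ with 𝔪^N ⊆ I_m(A), where I_m(A) is the ideal of maximal minors of A. -/
open IsLocalRing

/-- The Fitting ideal `I_r(A)`: the ideal generated by all `r × r` minors of `A`. -/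
def fittingIdeal {R : Type*} [CommRing R] {m n : ℕ} (r : ℕ)
    (A : Matrix (Fin m) (Fin n) R) : Ideal R :=
  Ideal.span { d : R | ∃ (f : Fin r → Fin m) (g : Fin r → Fin n),
    Function.Injective f ∧ Function.Injective g ∧ d = (A.submatrix f g).det }

open scoped Matrix

/-- A determinant of a product `A * C` lies in the ideal of maximal minors of `A`. -/
theorem det_mul_mem_fittingIdeal {R : Type*} [CommRing R] {m n : ℕ}
    (A : Matrix (Fin m) (Fin n) R) (C : Matrix (Fin n) (Fin m) R) :
    (A * C).det ∈ fittingIdeal m A := by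
  have hrows : (A * C).transpose = fun i => ∑ j, C j i • A.transpose j := by
    ext i a
    simp [Matrix.mul_apply, mul_comm]
  rw [← Matrix.det_transpose, hrows]
  change Matrix.detRowAlternating.toMultilinearMap (fun i => ∑ j, C j i • A.transpose j) ∈ _
  rw [MultilinearMap.map_sum]
  refine Ideal.sum_mem _ fun g _ => ?_
  rw [MultilinearMap.map_smul_univ, smul_eq_mul]
  refine Ideal.mul_mem_left _ _ ?_
  have hdet : Matrix.detRowAlternating.toMultilinearMap (fun i => A.transpose (g i)) =
      (A.submatrix id g).det := by
    rw [← Matrix.det_transpose]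
    rfl
  rw [hdet]
  by_cases hg : Function.Injective g
  · exact Ideal.subset_span ⟨id, g, Function.injective_id, hg, rfl⟩
  · obtain ⟨i, j, hij, hne⟩ := Function.not_injective_iff.mp hg
    rw [Matrix.det_zero_of_column_eq hne fun a => by simp [hij]]
    exact Ideal.zero_mem _

/-- The ideal of maximal minors of `A` multiplies every standard basis vector into the
column space of `A`. -/
theorem fittingIdeal_le_comap_range_mulVecLin {R : Type*} [CommRing R] {m n : ℕ}
    (A : Matrix (Fin m) (Fin n) R) (i : Fin m) :
    fittingIdeal m A ≤ (LinearMap.range A.mulVecLin).comap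
      (LinearMap.toSpanSingleton R (Fin m → R) (Pi.single i 1)) := by
  refine Ideal.span_le.mpr ?_
  rintro _ ⟨f, g, hf, -, rfl⟩
  let σ : Equiv.Perm (Fin m) := Equiv.ofBijective f (Finite.injective_iff_bijective.mp hf)
  have hdet : (A.submatrix f g).det = σ.sign * (A.submatrix id g).det :=
    Matrix.det_permute σ (A.submatrix id g)
  rw [hdet]
  refine Ideal.mul_mem_left
    ((LinearMap.range A.mulVecLin).comap
      (LinearMap.toSpanSingleton R (Fin m → R) (Pi.single i 1)) : Ideal R) _ ?_
  have hsub : A.submatrix id g = A * (1 : Matrix (Fin n) (Fin n) R).submatrix id g := by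
    ext a j
    simp [Matrix.mul_apply, Matrix.one_apply]
  refine ⟨(1 : Matrix (Fin n) (Fin n) R).submatrix id g *ᵥ
    ((A.submatrix id g).adjugate *ᵥ Pi.single i 1), ?_⟩
  rw [Matrix.mulVecLin_apply, Matrix.mulVec_mulVec, ← hsub, Matrix.mulVec_mulVec,
    Matrix.mul_adjugate, Matrix.smul_mulVec, Matrix.one_mulVec,
    LinearMap.toSpanSingleton_apply]

/-- A vector with entries in `J * I_m(A)` is the image under `A` of a vector with entries
in `J`. -/
theorem exists_mulVec_eq_of_mem_mul_fittingIdeal {R : Type*} [CommRing R] {m n : ℕ}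
    (A : Matrix (Fin m) (Fin n) R) (J : Ideal R) (b : Fin m → R)
    (hb : ∀ i, b i ∈ J * fittingIdeal m A) :
    ∃ w : Fin n → R, (∀ j, w j ∈ J) ∧ A *ᵥ w = b := by
  have hmem : b ∈ (J • (⊤ : Submodule R (Fin n → R))).map A.mulVecLin := by
    rw [pi_eq_sum_univ' b]
    refine Submodule.sum_mem _ fun i _ => ?_
    rw [Submodule.map_smul'', Submodule.map_top]
    have h := Submodule.mem_map_of_mem
      (f := LinearMap.toSpanSingleton R (Fin m → R) (Pi.single i 1)) (hb i)
    rw [← smul_eq_mul, Submodule.map_smul''] at h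
    have h' := Submodule.smul_mono (le_refl J)
      (Submodule.map_le_iff_le_comap.mpr (fittingIdeal_le_comap_range_mulVecLin A i)) h
    convert h' using 1
    ext a
    simp [Pi.single_apply, eq_comm]
  obtain ⟨w, hw, rfl⟩ := hmem
  refine ⟨w, fun j => ?_, rfl⟩
  have h := Submodule.mem_map_of_mem (f := LinearMap.proj (R := R) (φ := fun _ => R) j) hw
  rw [Submodule.map_smul''] at h
  exact Ideal.mul_le_left (Submodule.smul_mono (le_refl J) le_top h)

/-- Over a local ring, `1 + W` is invertible when `W` has entries in the maximal ideal. -/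
theorem isUnit_one_add_of_mem_maximalIdeal {R : Type*} [CommRing R] [IsLocalRing R] {n : ℕ}
    (W : Matrix (Fin n) (Fin n) R) (hW : ∀ i j, W i j ∈ maximalIdeal R) :
    IsUnit (1 + W) := by
  rw [Matrix.isUnit_iff_isUnit_det, ← isUnit_map_iff (residue R), RingHom.map_det, map_add,
    map_one]
  have hzero : (residue R).mapMatrix W = 0 := by
    ext i j
    simpa using hW i j
  simp [hzero]

/-- For `m ≤ n` and `A ∈ Mat(m,n;𝔪)`, `A` is finitely-`G_r`-determined
iff `𝔪^N ⊆ I_m(A)` for some `N`. -/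
theorem finite_Gr_determined_iff_pow_le_maximal_minors
    {k R : Type*} [Field k] [CharZero k] [CommRing R] [Algebra k R]
    [IsNoetherianRing R] [IsLocalRing R]
    {m n : ℕ} (hmn : m ≤ n)
    (A : Matrix (Fin m) (Fin n) R)
    (hA : ∀ i j, A i j ∈ maximalIdeal R) :
    (∃ k₀ : ℕ, ∀ B : Matrix (Fin m) (Fin n) R,
        (∀ i j, B i j ∈ (maximalIdeal R) ^ (k₀ + 1)) →
        ∃ V : Matrix (Fin n) (Fin n) R, IsUnit V ∧ A + B = A * V) ↔
    (∃ N : ℕ, (maximalIdeal R) ^ N ≤ fittingIdeal m A) := by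
  constructor
  · rintro ⟨k₀, h⟩
    refine ⟨(k₀ + 1) * m, ?_⟩
    rw [pow_mul, ← Ideal.span_eq (maximalIdeal R ^ (k₀ + 1)), Ideal.span, Submodule.span_pow]
    refine Ideal.span_le.mpr fun x hx => ?_
    obtain ⟨f, rfl⟩ := Set.mem_pow.mp hx
    let D : Matrix (Fin m) (Fin m) R := Matrix.diagonal fun i => (f i : R)
    have hcol : ∀ i, ∃ v : Fin n → R, A *ᵥ v = D.col i := by
      intro i
      obtain ⟨V, -, hV⟩ := h (Matrix.of fun a _ => D a i) fun a _ => by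
        simp only [D, Matrix.of_apply, Matrix.diagonal_apply]
        split_ifs
        · exact (f a).2
        · exact Ideal.zero_mem _
      let j := Fin.castLE hmn i
      refine ⟨(V - 1).col j, ?_⟩
      have hB : A * (V - 1) = Matrix.of fun a _ => D a i := by
        rw [Matrix.mul_sub, ← hV, Matrix.mul_one, add_sub_cancel_left]
      ext a
      exact congrFun (congrFun hB a) j
    choose v hv using hcol
    have hD : A * (Matrix.of v).transpose = D := by
      ext a i
      exact congrFun (hv i) a
    have hdet := det_mul_mem_fittingIdeal A (Matrix.of v).transpose
    rw [hD, Matrix.det_diagonal] at hdet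
    rwa [List.prod_ofFn]
  · rintro ⟨N, hN⟩
    refine ⟨N, fun B hB => ?_⟩
    have hcol : ∀ j, ∃ w : Fin n → R, (∀ i, w i ∈ maximalIdeal R) ∧ A *ᵥ w = B.col j :=
      fun j => exists_mulVec_eq_of_mem_mul_fittingIdeal A _ _ fun i =>
        Ideal.mul_mono_right hN (pow_succ' (maximalIdeal R) N ▸ hB i j)
    choose w hw hwB using hcol
    refine ⟨1 + (Matrix.of w).transpose,
      isUnit_one_add_of_mem_maximalIdeal _ fun i j => hw j i, ?_⟩
    rw [Matrix.mul_add, Matrix.mul_one, add_right_inj]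
    ext a j
    exact (congrFun (hwB j) a).symm
end

section
/- Let k be a field of characteristic zero, (R,𝔪) a Noetherian local k-algebra, m ≤ n, and A ∈ Mat(m,n;𝔪). Then A is finitely-G_{lr}-determined if and only if for every prime ideal J of R with J ≠ 𝔪 the following holds: the only matrix B ∈ Mat(n,m;R/J) satisfying Ā·B = 0 and B·Ā = 0 is B = 0, where Ā ∈ Mat(m,n;R/J) is the entrywise reduction of A modulo J. -/
open IsLocalRing

/-- Over a field, a matrix with `m ≤ n` that annihilates no nonzero matrix from both sides has a
right inverse. -/
theorem exists_right_inverse_of_two_sided_annihilator_eq_zero {K : Type*} [Field K] {m n : ℕ}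
    (hmn : m ≤ n) (A : Matrix (Fin m) (Fin n) K)
    (h : ∀ B : Matrix (Fin n) (Fin m) K, A * B = 0 → B * A = 0 → B = 0) :
    ∃ Y : Matrix (Fin n) (Fin m) K, A * Y = 1 := by
  by_cases hr : A.rank = m
  · rw [← Matrix.mulVec_surjective_iff_exists_right_inverse]
    have htop : LinearMap.range A.mulVecLin = ⊤ := by
      apply Submodule.eq_top_of_finrank_eq
      rw [← Matrix.rank, hr]
      simp
    exact LinearMap.range_eq_top.mp htop
  · exfalso
    have hlt : A.rank < m := lt_of_le_of_ne (by simpa using A.rank_le_height) hr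
    have hker : ∀ {p q : ℕ} (M : Matrix (Fin p) (Fin q) K), M.rank < q →
        ∃ w : Fin q → K, w ≠ 0 ∧ M.mulVec w = 0 := by
      intro p q M hM
      have hsum := LinearMap.finrank_range_add_finrank_ker M.mulVecLin
      rw [← Matrix.rank, Module.finrank_fin_fun] at hsum
      have hne : LinearMap.ker M.mulVecLin ≠ ⊥ := by
        intro h0
        rw [h0, finrank_bot] at hsum
        omega
      obtain ⟨w, hw, hw0⟩ := Submodule.exists_mem_ne_zero_of_ne_bot hne
      exact ⟨w, hw0, by simpa using hw⟩
    obtain ⟨w, hw0, hw⟩ := hker A (hlt.trans_le hmn)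
    obtain ⟨v, hv0, hv⟩ := hker A.transpose (by rwa [Matrix.rank_transpose])
    rw [Matrix.mulVec_transpose] at hv
    have hB := h (Matrix.vecMulVec w v)
      (by rw [Matrix.mul_vecMulVec, hw, Matrix.zero_vecMulVec])
      (by rw [Matrix.vecMulVec_mul, hv, Matrix.vecMulVec_zero])
    obtain ⟨i, hi⟩ := Function.ne_iff.mp hw0
    obtain ⟨j, hj⟩ := Function.ne_iff.mp hv0
    exact mul_ne_zero hi hj (congrFun (congrFun hB i) j)

/-- A matrix over the fraction field of a domain has a common denominator. -/
theorem exists_matrix_map_eq_smul {S : Type*} [CommRing S] [IsDomain S] {m n : ℕ}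
    (B : Matrix (Fin n) (Fin m) (FractionRing S)) :
    ∃ (s : S) (B' : Matrix (Fin n) (Fin m) S), s ≠ 0 ∧
      B'.map (algebraMap S (FractionRing S)) = algebraMap S (FractionRing S) s • B := by
  obtain ⟨s, hs⟩ := IsLocalization.exist_integer_multiples_of_finite (nonZeroDivisors S)
    (fun p : Fin n × Fin m => B p.1 p.2)
  choose B' hB' using hs
  refine ⟨s, Matrix.of fun i j => B' (i, j), nonZeroDivisors.coe_ne_zero s, ?_⟩
  ext i j
  simpa [Algebra.smul_def] using hB' (i, j)

/-- Over a domain, a matrix with `m ≤ n` that annihilates no nonzero matrix from both sides has a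
right inverse up to a nonzero scalar. -/
theorem exists_mul_eq_smul_one_of_two_sided_annihilator_eq_zero {S : Type*} [CommRing S]
    [IsDomain S] {m n : ℕ} (hmn : m ≤ n) (A : Matrix (Fin m) (Fin n) S)
    (h : ∀ B : Matrix (Fin n) (Fin m) S, A * B = 0 → B * A = 0 → B = 0) :
    ∃ (s : S) (Y : Matrix (Fin n) (Fin m) S), s ≠ 0 ∧ A * Y = s • 1 := by
  set f := algebraMap S (FractionRing S)
  have hf : Function.Injective f := IsFractionRing.injective S (FractionRing S)
  obtain ⟨Z, hZ⟩ := exists_right_inverse_of_two_sided_annihilator_eq_zero hmn (A.map f) (by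
    intro B h1 h2
    obtain ⟨s, B', hs, hB'⟩ := exists_matrix_map_eq_smul B
    have hB0 : B' = 0 := by
      apply h
      · apply Matrix.map_injective hf
        simp only [Matrix.map_mul]
        rw [hB', Matrix.mul_smul, h1]
        ext; simp
      · apply Matrix.map_injective hf
        simp only [Matrix.map_mul]
        rw [hB', Matrix.smul_mul, h2]
        ext; simp
    have hs0 : f s ≠ 0 := (map_ne_zero_iff f hf).mpr hs
    refine (smul_eq_zero_iff_right hs0).mp ?_
    rw [← hB', hB0]
    ext; simp)
  obtain ⟨s, Y, hs, hY⟩ := exists_matrix_map_eq_smul Z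
  refine ⟨s, Y, hs, ?_⟩
  apply Matrix.map_injective hf
  simp only [Matrix.map_mul]
  rw [hY, Matrix.mul_smul, hZ]
  ext i j
  by_cases hij : i = j <;> simp [hij, f]

/-- The ideal of scalars `s` such that `s • 1` is a right multiple of `A`. -/
def Matrix.rightScalarIdeal {R : Type*} [CommRing R] {m n : ℕ} (A : Matrix (Fin m) (Fin n) R) :
    Ideal R where
  carrier := {s | ∃ Y : Matrix (Fin n) (Fin m) R, A * Y = s • 1}
  zero_mem' := ⟨0, by simp⟩
  add_mem' := by
    rintro a b ⟨Y, hY⟩ ⟨Z, hZ⟩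
    exact ⟨Y + Z, by rw [Matrix.mul_add, hY, hZ, add_smul]⟩
  smul_mem' := by
    rintro c a ⟨Y, hY⟩
    exact ⟨c • Y, by rw [Matrix.mul_smul, hY, smul_smul, smul_eq_mul]⟩

theorem Matrix.mem_rightScalarIdeal {R : Type*} [CommRing R] {m n : ℕ}
    {A : Matrix (Fin m) (Fin n) R} {s : R} :
    s ∈ A.rightScalarIdeal ↔ ∃ Y : Matrix (Fin n) (Fin m) R, A * Y = s • 1 :=
  Iff.rfl

/-- If the reduction of `A` modulo a prime `J` annihilates no nonzero matrix from both sides, then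
`A.rightScalarIdeal` is not contained in `J`. -/
theorem not_rightScalarIdeal_le_of_two_sided_annihilator_eq_zero {R : Type*} [CommRing R] {m n : ℕ}
    (hmn : m ≤ n) (A : Matrix (Fin m) (Fin n) R) (J : Ideal R) [J.IsPrime]
    (h : ∀ B : Matrix (Fin n) (Fin m) (R ⧸ J), A.map (Ideal.Quotient.mk J) * B = 0 →
      B * A.map (Ideal.Quotient.mk J) = 0 → B = 0) :
    ¬ A.rightScalarIdeal ≤ J := by
  intro hle
  obtain ⟨s, Y, hs, hY⟩ := exists_mul_eq_smul_one_of_two_sided_annihilator_eq_zero hmn _ h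
  choose g hg using Ideal.Quotient.mk_surjective (I := J)
  have hYg : (Y.map g).map (Ideal.Quotient.mk J) = Y := by
    ext i j
    simp [hg]
  have hmem : (A * Y.map g).det ∈ A.rightScalarIdeal :=
    ⟨Y.map g * (A * Y.map g).adjugate, by rw [← Matrix.mul_assoc, Matrix.mul_adjugate]⟩
  have hdet := Ideal.Quotient.eq_zero_iff_mem.mpr (hle hmem)
  rw [RingHom.map_det, RingHom.mapMatrix_apply, Matrix.map_mul, hYg, hY, Matrix.det_smul,
    Matrix.det_one, mul_one] at hdet
  exact pow_ne_zero _ hs hdet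

/-- If every entry of `B` lies in `I * A.rightScalarIdeal`, then `B` is a right multiple of `A` by
a matrix with entries in `I`. -/
theorem exists_mul_eq_of_mem_mul_rightScalarIdeal {R : Type*} [CommRing R] {m n : ℕ}
    (A B : Matrix (Fin m) (Fin n) R) (I : Ideal R)
    (hB : ∀ i j, B i j ∈ I * A.rightScalarIdeal) :
    ∃ Y : Matrix (Fin n) (Fin n) R, (∀ i j, Y i j ∈ I) ∧ A * Y = B := by
  have key : ∀ b ∈ I * A.rightScalarIdeal, ∃ Y : Matrix (Fin n) (Fin m) R,
      (∀ i j, Y i j ∈ I) ∧ A * Y = b • 1 := by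
    intro b hb
    refine Submodule.mul_induction_on hb ?_ ?_
    · rintro a ha s ⟨Y, hY⟩
      exact ⟨a • Y, fun i j => I.mul_mem_right _ ha, by rw [Matrix.mul_smul, hY, smul_smul]⟩
    · rintro a b ⟨Y, hYI, hY⟩ ⟨Z, hZI, hZ⟩
      exact ⟨Y + Z, fun i j => I.add_mem (hYI i j) (hZI i j),
        by rw [Matrix.mul_add, hY, hZ, add_smul]⟩
  choose Y hYI hY using fun i j => key _ (hB i j)
  refine ⟨∑ i, ∑ j, Y i j * Matrix.single i j (1 : R), fun p q => ?_, ?_⟩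
  · simp only [Matrix.sum_apply, Matrix.mul_apply]
    exact I.sum_mem fun i _ => I.sum_mem fun j _ => I.sum_mem fun l _ =>
      I.mul_mem_right _ (hYI i j p l)
  · simp only [Matrix.mul_sum, ← Matrix.mul_assoc, hY, Matrix.smul_mul, Matrix.one_mul]
    conv_rhs => rw [Matrix.matrix_eq_sum_single B]
    simp [Matrix.smul_single]

theorem isUnit_one_add_of_entries_mem_maximalIdeal {R : Type*} [CommRing R] [IsLocalRing R] {n : ℕ}
    (Y : Matrix (Fin n) (Fin n) R) (hY : ∀ i j, Y i j ∈ maximalIdeal R) : IsUnit (1 + Y) := by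
  rw [Matrix.isUnit_iff_isUnit_det]
  apply isUnit_of_map_unit (residue R)
  have hmap : Y.map (residue R) = 0 := by
    ext i j
    exact (residue_eq_zero_iff _).mpr (hY i j)
  rw [RingHom.map_det, map_add, map_one, RingHom.mapMatrix_apply, hmap, add_zero, Matrix.det_one]
  exact isUnit_one

/-- The vanishing of a nontrivial combination of the rows of `M` is preserved by two-sided
multiplication with matrices, the left one being invertible. -/
theorem exists_vecMul_mul_mul_eq_zero {S : Type*} [CommRing S] {m n : ℕ}
    {M : Matrix (Fin m) (Fin n) S} {U : Matrix (Fin m) (Fin m) S} (hU : IsUnit U)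
    (V : Matrix (Fin n) (Fin n) S) {v : Fin m → S} (hv : v ≠ 0) (hvM : Matrix.vecMul v M = 0) :
    ∃ w : Fin m → S, w ≠ 0 ∧ Matrix.vecMul w (U * M * V) = 0 := by
  obtain ⟨u, rfl⟩ := hU
  refine ⟨Matrix.vecMul v (↑u⁻¹ : Matrix (Fin m) (Fin m) S), fun h => hv ?_, ?_⟩
  · have := congrArg (fun x => Matrix.vecMul x (u : Matrix (Fin m) (Fin m) S)) h
    simpa [Matrix.vecMul_vecMul] using this
  · rw [Matrix.vecMul_vecMul, ← Matrix.mul_assoc, ← Matrix.mul_assoc, Units.inv_mul,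
      Matrix.one_mul, ← Matrix.vecMul_vecMul, hvM, Matrix.zero_vecMul]

/-- Over a domain, `M + t • [1 | 0]` has linearly dependent rows for only finitely many `t`. -/
theorem finite_setOf_exists_vecMul_add_smul_eq_zero {S : Type*} [CommRing S] [IsDomain S] {m n : ℕ}
    (hmn : m ≤ n) (M : Matrix (Fin m) (Fin n) S) :
    {t : S | ∃ w : Fin m → S, w ≠ 0 ∧ Matrix.vecMul w
      (M + t • (1 : Matrix (Fin n) (Fin n) S).submatrix (Fin.castLE hmn) id) = 0}.Finite := by
  by_contra hinf
  set N := M.submatrix id (Fin.castLE hmn)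
  refine (-N).charpoly_monic.ne_zero (Polynomial.eq_zero_of_infinite_isRoot _
    (Set.Infinite.mono ?_ hinf))
  rintro t ⟨w, hw0, hw⟩
  rw [Set.mem_ofPred_eq, Polynomial.IsRoot, Matrix.eval_charpoly,
    ← Matrix.exists_vecMul_eq_zero_iff]
  refine ⟨w, hw0, funext fun j => ?_⟩
  refine Eq.trans ?_ (congrFun hw (Fin.castLE hmn j))
  simp only [Matrix.vecMul, dotProduct]
  refine Finset.sum_congr rfl fun i _ => ?_
  by_cases hij : i = j <;> simp [N, hij, Matrix.one_apply, add_comm]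

/-- For `m ≤ n` and `A ∈ Mat(m,n;𝔪)`, `A` is finitely-`G_{lr}`-determined
iff for every prime ideal `J ≠ 𝔪` the only matrix `B ∈ Mat(n,m;R/J)` with
`Ā·B = 0` and `B·Ā = 0` is `B = 0`, where `Ā` is the entrywise reduction of `A` mod `J`. -/
theorem finite_Glr_determined_iff_trivial_kernel_mod_primes
    {k R : Type*} [Field k] [CharZero k] [CommRing R] [Algebra k R]
    [IsNoetherianRing R] [IsLocalRing R]
    {m n : ℕ} (hmn : m ≤ n)
    (A : Matrix (Fin m) (Fin n) R)
    (hA : ∀ i j, A i j ∈ maximalIdeal R) :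
    (∃ k₀ : ℕ, ∀ B : Matrix (Fin m) (Fin n) R,
        (∀ i j, B i j ∈ (maximalIdeal R) ^ (k₀ + 1)) →
        ∃ (U : Matrix (Fin m) (Fin m) R) (V : Matrix (Fin n) (Fin n) R),
          IsUnit U ∧ IsUnit V ∧ A + B = U * A * V) ↔
    (∀ J : Ideal R, J.IsPrime → J ≠ maximalIdeal R →
      ∀ B : Matrix (Fin n) (Fin m) (R ⧸ J),
        (A.map (Ideal.Quotient.mk J)) * B = 0 →
        B * (A.map (Ideal.Quotient.mk J)) = 0 →
        B = 0) := by
  constructor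
  · rintro ⟨k₀, hk⟩ J hJ hJm B - hBA
    by_contra hB
    obtain ⟨p, hp⟩ := Function.ne_iff.mp hB
    have hv : Matrix.vecMul (B p) (A.map (Ideal.Quotient.mk J)) = 0 := congrFun hBA p
    obtain ⟨s, hsm, hsJ⟩ := SetLike.exists_of_lt
      (lt_of_le_of_ne (le_maximalIdeal hJ.ne_top) hJm)
    have : CharZero (R ⧸ J) :=
      charZero_of_injective_algebraMap (algebraMap k (R ⧸ J)).injective
    have hs0 : Ideal.Quotient.mk J (s ^ (k₀ + 1)) ≠ 0 := fun h =>
      hsJ (hJ.mem_of_pow_mem _ (Ideal.Quotient.eq_zero_iff_mem.mp h))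
    have hinj : Function.Injective
        (fun c : ℕ => (c : R ⧸ J) * Ideal.Quotient.mk J (s ^ (k₀ + 1))) := fun a b hab =>
      Nat.cast_injective (mul_right_cancel₀ hs0 hab)
    refine (Set.infinite_range_of_injective hinj)
      ((finite_setOf_exists_vecMul_add_smul_eq_zero hmn (A.map (Ideal.Quotient.mk J))).subset ?_)
    rintro _ ⟨c, rfl⟩
    obtain ⟨U, V, hU, -, hUV⟩ := hk
      (((c : R) * s ^ (k₀ + 1)) • (1 : Matrix (Fin n) (Fin n) R).submatrix (Fin.castLE hmn) id)
      (fun i j => Ideal.mul_mem_right _ _ (Ideal.mul_mem_left _ _ (Ideal.pow_mem_pow hsm _)))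
    obtain ⟨w, hw0, hw⟩ := exists_vecMul_mul_mul_eq_zero
      (hU.map (Ideal.Quotient.mk J).mapMatrix) (V.map (Ideal.Quotient.mk J)) hp hv
    refine ⟨w, hw0, ?_⟩
    rw [RingHom.mapMatrix_apply, ← Matrix.map_mul, ← Matrix.map_mul, ← hUV] at hw
    convert hw using 2
    ext i j
    by_cases hij : Fin.castLE hmn i = j <;> simp [hij, Matrix.one_apply]
  · intro h
    have hrad : maximalIdeal R ≤ A.rightScalarIdeal.radical := by
      rw [Ideal.radical_eq_sInf]
      refine le_sInf ?_
      rintro J ⟨hle, hJ⟩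
      by_contra hJm
      exact not_rightScalarIdeal_le_of_two_sided_annihilator_eq_zero hmn A J
        (h J hJ fun heq => hJm heq.ge) hle
    obtain ⟨N, hN⟩ := Ideal.exists_pow_le_of_le_radical_of_fg hrad
      (IsNoetherian.noetherian (maximalIdeal R))
    refine ⟨N, fun B hB => ?_⟩
    obtain ⟨Y, hYm, hY⟩ := exists_mul_eq_of_mem_mul_rightScalarIdeal A B (maximalIdeal R)
      (fun i j => Ideal.mul_mono_right hN (by simpa only [pow_succ'] using hB i j))
    exact ⟨1, 1 + Y, isUnit_one, isUnit_one_add_of_entries_mem_maximalIdeal Y hYm,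
      by rw [Matrix.one_mul, Matrix.mul_add, Matrix.mul_one, hY]⟩
end

section
/- Let k be a field of characteristic zero, (R,𝔪) a henselian Noetherian local k-algebra, m ≤ n, dim R ≤ n - m + 1, and A ∈ Mat(m,n;𝔪). Then A is finitely-𝒢_{lr}-determined if and only if A is finitely-G_r-determined. -/
open IsLocalRing

/-- A coset of a subspace `N` is not covered by finitely many subspaces that do not contain `N`. -/
theorem Submodule.exists_mem_add_notMem {k M ι : Type*} [Field k] [Infinite k] [AddCommGroup M]
    [Module k M] [Finite ι] (N : Submodule k M) (W : ι → Submodule k M)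
    (hW : ∀ i, ¬ N ≤ W i) (a : M) : ∃ b ∈ N, ∀ i, a + b ∉ W i := by
  let F : k × N →ₗ[k] M :=
    (LinearMap.toSpanSingleton k M a).coprod N.subtype
  let P : Option ι → Submodule k (k × N) := fun o =>
    o.elim (LinearMap.ker (LinearMap.fst k k N)) fun i => (W i).comap F
  have hP : ⋃ o, (P o : Set (k × N)) ≠ Set.univ := by
    intro h
    obtain ⟨o, ho⟩ := Subspace.exists_eq_top_of_iUnion_eq_univ h
    cases o with
    | none =>
      have : ((1 : k), (0 : N)) ∈ P none := ho ▸ Submodule.mem_top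
      simp [P] at this
    | some i =>
      refine hW i fun b hb => ?_
      have : ((0 : k), (⟨b, hb⟩ : N)) ∈ P (some i) := ho ▸ Submodule.mem_top
      simpa [P, F] using this
  obtain ⟨⟨t, b⟩, h⟩ := (Set.ne_univ_iff_exists_notMem _).1 hP
  simp only [Set.mem_iUnion, not_exists] at h
  have ht : t ≠ 0 := by simpa [P] using h none
  refine ⟨t⁻¹ • (b : M), N.smul_mem _ b.2, fun i hi => h (some i) ?_⟩
  have := (W i).smul_mem t hi
  simpa [P, F, smul_smul, ht] using this

namespace Matrix

variable {m n : ℕ}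

theorem submatrix_updateCol_of_lt {R : Type*} (C : Matrix (Fin m) (Fin n) R) {r : ℕ}
    (j : Fin n) (v : Fin m → R) (f : Fin r → Fin m)
    {g : Fin r → Fin n} (hg : ∀ i, (g i : ℕ) < j) :
    (C.updateCol j v).submatrix f g = C.submatrix f g := by
  ext a b
  have : g b ≠ j := fun h => (hg b).ne (congrArg Fin.val h)
  simp [this]

theorem submatrix_updateCol_cons {R : Type*} (C : Matrix (Fin m) (Fin n) R) {r : ℕ}
    (j : Fin n) (v : Fin m → R) (f : Fin (r + 1) → Fin m)
    {g : Fin r → Fin n} (hg : ∀ i, (g i : ℕ) < j) :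
    (C.updateCol j v).submatrix f (Fin.cons j g : Fin (r + 1) → Fin n) =
      (C.submatrix f (Fin.cons j g : Fin (r + 1) → Fin n)).updateCol 0 (v ∘ f) := by
  ext a b
  cases b using Fin.cases with
  | zero => simp
  | succ b =>
    have : g b ≠ j := fun h => (hg b).ne (congrArg Fin.val h)
    simp [this]

variable {R : Type*} [CommRing R]

/-- The ideal generated by the minors of size `r` that involve only the first `j` columns. -/
def minorIdeal (C : Matrix (Fin m) (Fin n) R) (r j : ℕ) : Ideal R :=
  Ideal.span {x | ∃ (f : Fin r → Fin m) (g : Fin r → Fin n),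
    (∀ i, (g i : ℕ) < j) ∧ x = (C.submatrix f g).det}

theorem minorIdeal_le_iff {C : Matrix (Fin m) (Fin n) R} {r j : ℕ} {p : Ideal R} :
    C.minorIdeal r j ≤ p ↔ ∀ (f : Fin r → Fin m) (g : Fin r → Fin n),
      (∀ i, (g i : ℕ) < j) → (C.submatrix f g).det ∈ p := by
  rw [minorIdeal, Ideal.span_le]
  constructor
  · exact fun h f g hg => h ⟨f, g, hg, rfl⟩
  · rintro h _ ⟨f, g, hg, rfl⟩
    exact h f g hg

theorem minorIdeal_zero (C : Matrix (Fin m) (Fin n) R) (j : ℕ) : C.minorIdeal 0 j = ⊤ := by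
  rw [Ideal.eq_top_iff_one]
  exact Ideal.subset_span ⟨Fin.elim0, Fin.elim0, fun i => i.elim0, by simp⟩

theorem minorIdeal_updateCol_mono (C : Matrix (Fin m) (Fin n) R) (r : ℕ) (j : Fin n)
    (v : Fin m → R) : C.minorIdeal r j ≤ (C.updateCol j v).minorIdeal r (j + 1) := by
  rw [minorIdeal_le_iff]
  intro f g hg
  rw [← C.submatrix_updateCol_of_lt j v f hg]
  exact Ideal.subset_span ⟨f, g, fun i => (hg i).trans (Nat.lt_succ_self _), rfl⟩

/-- The vectors `v` for which replacing column `i` of `D` by the entries of `v` at `f` makes the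
determinant lie in `p`. -/
def detUpdateColSubmodule {ι κ : Type*} [Fintype ι] [DecidableEq ι] (D : Matrix ι ι R) (i : ι)
    (f : ι → κ) (p : Ideal R) : Submodule R (κ → R) where
  carrier := {v | (D.updateCol i (v ∘ f)).det ∈ p}
  zero_mem' := by
    have : ((0 : κ → R) ∘ f) = (0 : R) • (0 : ι → R) := by ext; simp
    simp only [Set.mem_ofPred_eq, this, det_updateCol_smul, zero_mul, zero_mem]
  add_mem' {u v} hu hv := by
    have : (u + v) ∘ f = u ∘ f + v ∘ f := rfl
    simpa only [Set.mem_ofPred_eq, this, det_updateCol_add] using p.add_mem hu hv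
  smul_mem' c v hv := by
    have : (c • v) ∘ f = c • (v ∘ f) := rfl
    simpa only [Set.mem_ofPred_eq, this, det_updateCol_smul] using p.mul_mem_left c hv

/-- If some minor of size `r < m` in the first `j` columns avoids the prime `p`, then replacing
column `j` by a vector outside a suitable submodule gives a minor of size `r + 1` avoiding `p`. -/
theorem exists_submodule_minorIdeal_updateCol (C : Matrix (Fin m) (Fin n) R) {r : ℕ} (hr : r < m)
    (j : Fin n) {p J : Ideal R} [p.IsPrime] (hJ : ¬ J ≤ p) (hC : ¬ C.minorIdeal r j ≤ p) :
    ∃ W : Submodule R (Fin m → R), ¬ Submodule.pi Set.univ (fun _ => J) ≤ W ∧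
      ∀ v, v ∉ W → ¬ (C.updateCol j v).minorIdeal (r + 1) (j + 1) ≤ p := by
  simp only [minorIdeal_le_iff, not_forall] at hC
  obtain ⟨f, g, hg, hδ⟩ := hC
  obtain ⟨i, hi⟩ : ∃ i, i ∉ Set.range f := by
    by_contra! h
    have := Fintype.card_le_of_surjective f h
    simp at this
    omega
  obtain ⟨s, hsJ, hsp⟩ := SetLike.not_le_iff_exists.1 hJ
  refine ⟨detUpdateColSubmodule (C.submatrix (Fin.cons i f : Fin (r + 1) → Fin m)
    (Fin.cons j g : Fin (r + 1) → Fin n)) 0 (Fin.cons i f : Fin (r + 1) → Fin m) p,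
    fun h => ?_, fun v hv h => hv ?_⟩
  · have hmem : Pi.single i s ∈ Submodule.pi Set.univ (fun _ : Fin m => J) := by
      intro l _
      by_cases hl : l = i
      · subst hl; simpa using hsJ
      · simp [hl]
    have hdet : ((C.submatrix (Fin.cons i f : Fin (r + 1) → Fin m)
        (Fin.cons j g : Fin (r + 1) → Fin n)).updateCol 0
        (Pi.single i s ∘ (Fin.cons i f : Fin (r + 1) → Fin m))).det ∈ p := h hmem
    have hf : ∀ l, f l ≠ i := fun l hl => hi ⟨l, hl⟩
    rw [det_succ_column_zero, Fin.sum_univ_succ] at hdet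
    simp only [updateCol_self, Function.comp_apply, Fin.cons_zero, Fin.cons_succ, Pi.single_eq_same,
      Pi.single_eq_of_ne (hf _), mul_zero, zero_mul, Finset.sum_const_zero, add_zero,
      Fin.val_zero, pow_zero, one_mul] at hdet
    refine ((Ideal.IsPrime.mem_or_mem ‹_› hdet).resolve_left hsp |> fun h => hδ ?_)
    convert h using 2
    ext a b
    simp
  · rw [minorIdeal_le_iff] at h
    have := h (Fin.cons i f) (Fin.cons j g) fun l => by
      cases l using Fin.cases with
      | zero => simp
      | succ l => simpa using (hg l).trans (Nat.lt_succ_self _)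
    rwa [submatrix_updateCol_cons _ _ _ _ hg] at this

/-- The prime avoidance step: one column can be modified within `J` so that the expected
codimension of the ideals of minors persists when this column is taken into account. -/
theorem exists_updateCol_minorIdeal (k : Type*) [Field k] [Infinite k] [Algebra k R]
    [IsNoetherianRing R] (J : Ideal R) (C : Matrix (Fin m) (Fin n) R) (j : Fin n)
    (hC : ∀ (p : Ideal R) [p.IsPrime], ¬ J ≤ p → ∀ r ≤ m, p.height + r ≤ ((j : ℕ) : ℕ∞) →
      ¬ C.minorIdeal r j ≤ p) :
    ∃ b : Fin m → R, (∀ i, b i ∈ J) ∧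
      ∀ (p : Ideal R) [p.IsPrime], ¬ J ≤ p → ∀ r ≤ m, p.height + r ≤ ((j + 1 : ℕ) : ℕ∞) →
      ¬ (C.updateCol j (C.col j + b)).minorIdeal r (j + 1) ≤ p := by
  let S : Set (Fin m × Ideal R) := {x | x.2.IsPrime ∧ ¬ J ≤ x.2 ∧
    x.2.height + (x.1 : ℕ) ≤ ((j : ℕ) : ℕ∞) ∧ C.minorIdeal (x.1 + 1) j ≤ x.2}
  have hS : S.Finite := by
    have hfin : (⋃ r : Fin m, Prod.mk r '' (C.minorIdeal (r + 1) j).minimalPrimes).Finite :=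
      Set.finite_iUnion fun r =>
        (Ideal.finite_minimalPrimes_of_isNoetherianRing R _).image _
    refine hfin.subset ?_
    rintro ⟨r, p⟩ ⟨hp, hJp, hht, hle⟩
    simp only at hp hJp hht hle
    refine Set.mem_iUnion.2 ⟨r, p, ?_, rfl⟩
    obtain ⟨q, hq, hqp⟩ := Ideal.exists_minimalPrimes_le hle
    have := hq.1.1
    rcases hqp.eq_or_lt with rfl | hlt
    · exact hq
    · refine absurd hq.1.2 (hC q (fun h => hJp (h.trans hqp)) (r + 1) r.2 ?_)
      refine le_trans ?_ hht
      have := Ideal.height_add_one_le_of_lt_of_isPrime hlt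
      calc q.height + ((r + 1 : ℕ) : ℕ∞) = q.height + 1 + (r : ℕ) := by push_cast; ring
        _ ≤ _ := by gcongr
  have hW : ∀ x : S, ∃ W : Submodule R (Fin m → R),
      ¬ Submodule.pi Set.univ (fun _ => J) ≤ W ∧
      ∀ v, v ∉ W → ¬ (C.updateCol j v).minorIdeal (x.1.1 + 1) (j + 1) ≤ x.1.2 := by
    rintro ⟨⟨r, p⟩, hp, hJp, hht, hle⟩
    exact C.exists_submodule_minorIdeal_updateCol r.2 j hJp (hC p hJp r r.2.le hht)
  choose W hWJ hWv using hW
  have : Finite S := hS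
  obtain ⟨b, hb, hbW⟩ := Submodule.exists_mem_add_notMem
    ((Submodule.pi Set.univ (fun _ : Fin m => J)).restrictScalars k)
    (fun x => (W x).restrictScalars k) (fun x h => hWJ x h) (C.col j)
  refine ⟨b, fun i => hb i trivial, fun p hp hJp r hr hht => ?_⟩
  cases r with
  | zero => rw [minorIdeal_zero]; exact fun h => hp.ne_top (top_le_iff.1 h)
  | succ r =>
    have hht' : p.height + r ≤ ((j : ℕ) : ℕ∞) := by
      push_cast at hht
      rw [← add_assoc] at hht
      exact (ENat.add_le_add_iff_right ENat.one_ne_top).1 hht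
    by_cases hle : C.minorIdeal (r + 1) j ≤ p
    · exact hWv ⟨⟨⟨r, hr⟩, p⟩, hp, hJp, hht', hle⟩ _ (hbW _)
    · exact fun h => hle ((C.minorIdeal_updateCol_mono _ j _).trans h)

/-- Modulo any ideal `J`, a matrix can be modified so that its ideals of minors have the expected
codimension away from the vanishing locus of `J`. -/
theorem exists_add_minorIdeal (k : Type*) [Field k] [Infinite k] [Algebra k R]
    [IsNoetherianRing R] (J : Ideal R) (A : Matrix (Fin m) (Fin n) R) :
    ∃ B : Matrix (Fin m) (Fin n) R, (∀ i l, B i l ∈ J) ∧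
      ∀ (p : Ideal R) [p.IsPrime], ¬ J ≤ p → ∀ r ≤ m, p.height + r ≤ (n : ℕ∞) →
      ¬ (A + B).minorIdeal r n ≤ p := by
  suffices H : ∀ j ≤ n, ∃ B : Matrix (Fin m) (Fin n) R, (∀ i l, B i l ∈ J) ∧
      ∀ (p : Ideal R) [p.IsPrime], ¬ J ≤ p → ∀ r ≤ m, p.height + r ≤ (j : ℕ∞) →
      ¬ (A + B).minorIdeal r j ≤ p from H n le_rfl
  intro j hj
  induction j with
  | zero =>
    refine ⟨0, fun _ _ => J.zero_mem, fun p hp _ r _ h => ?_⟩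
    have hr : r = 0 := by
      have := le_add_self.trans h
      simpa using this
    rw [hr, minorIdeal_zero]
    exact fun h => hp.ne_top (top_le_iff.1 h)
  | succ j ih =>
    obtain ⟨B, hB, hC⟩ := ih (Nat.le_of_succ_le hj)
    obtain ⟨b, hb, H⟩ := exists_updateCol_minorIdeal k J (A + B) ⟨j, hj⟩ hC
    refine ⟨B.updateCol ⟨j, hj⟩ (B.col ⟨j, hj⟩ + b), fun i l => ?_, ?_⟩
    · by_cases hl : l = ⟨j, hj⟩
      · subst hl
        simpa using J.add_mem (hB _ _) (hb i)
      · simpa [hl] using hB i l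
    · have hAB : A + B.updateCol ⟨j, hj⟩ (B.col ⟨j, hj⟩ + b) =
          (A + B).updateCol ⟨j, hj⟩ ((A + B).col ⟨j, hj⟩ + b) := by
        ext i l
        by_cases hl : l = ⟨j, hj⟩
        · subst hl
          simp [add_assoc]
        · simp [hl]
      rwa [hAB]

/-- The annihilator of the cokernel of a matrix. -/
def cokerAnnihilator {ι κ : Type*} [Fintype κ] (C : Matrix ι κ R) : Ideal R where
  carrier := {x | ∀ v : ι → R, ∃ w, x • v = C *ᵥ w}
  zero_mem' v := ⟨0, by simp⟩
  add_mem' {x y} hx hy v := by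
    obtain ⟨u, hu⟩ := hx v
    obtain ⟨w, hw⟩ := hy v
    exact ⟨u + w, by rw [add_smul, hu, hw, mulVec_add]⟩
  smul_mem' c x hx v := by
    obtain ⟨u, hu⟩ := hx v
    exact ⟨c • u, by rw [smul_eq_mul, mul_smul, hu, mulVec_smul]⟩

theorem minorIdeal_le_cokerAnnihilator (C : Matrix (Fin m) (Fin n) R) (j : ℕ) :
    C.minorIdeal m j ≤ C.cokerAnnihilator := by
  rw [minorIdeal_le_iff]
  intro f g _
  have key : C.submatrix f g =
      (1 : Matrix (Fin m) (Fin m) R).submatrix f id * C.submatrix id g := by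
    rw [← submatrix_mul _ _ f id g Function.bijective_id, Matrix.one_mul]
  rw [key, det_mul]
  refine Ideal.mul_mem_left _ _ fun v => ?_
  refine ⟨(1 : Matrix (Fin n) (Fin n) R).submatrix id g *ᵥ ((C.submatrix id g).adjugate *ᵥ v), ?_⟩
  have hcols : C * (1 : Matrix (Fin n) (Fin n) R).submatrix id g = C.submatrix id g := by
    have := submatrix_mul C (1 : Matrix (Fin n) (Fin n) R) id id g Function.bijective_id
    rw [Matrix.mul_one] at this
    simpa using this.symm
  rw [mulVec_mulVec, hcols, mulVec_mulVec, mul_adjugate, smul_mulVec, one_mulVec]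

theorem pow_maximalIdeal_le_cokerAnnihilator_of_equiv [IsLocalRing R] {ι κ : Type*} [Fintype ι]
    [DecidableEq ι] [Fintype κ] {A C : Matrix ι κ R} {U : Matrix ι ι R} {V : Matrix κ κ R}
    (φ : R ≃+* R) (hU : IsUnit U) (hC : C = U * A.map φ * V) {N : ℕ}
    (h : maximalIdeal R ^ N ≤ C.cokerAnnihilator) :
    maximalIdeal R ^ N ≤ A.cokerAnnihilator := by
  have hφ : (maximalIdeal R).map (φ : R →+* R) ≤ maximalIdeal R := by
    rw [Ideal.map_le_iff_le_comap]
    intro x hx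
    simpa [mem_maximalIdeal] using hx
  intro x hx v
  have hφx : φ x ∈ maximalIdeal R ^ N := by
    have := Ideal.mem_map_of_mem (φ : R →+* R) hx
    rw [Ideal.map_pow] at this
    exact Ideal.pow_right_mono hφ N this
  obtain ⟨w, hw⟩ := h hφx (U *ᵥ (φ ∘ v))
  obtain ⟨u, rfl⟩ := hU
  have hw' : φ x • (φ ∘ v) = A.map φ *ᵥ (V *ᵥ w) := by
    have := congrArg (fun z => (↑u⁻¹ : Matrix ι ι R) *ᵥ z) hw
    simpa only [hC, mulVec_smul, mulVec_mulVec, ← Matrix.mul_assoc, Units.inv_mul, Matrix.one_mul,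
      one_mulVec] using this
  refine ⟨φ.symm ∘ (V *ᵥ w), ?_⟩
  ext i
  apply φ.injective
  have := congrFun hw' i
  simp only [Pi.smul_apply, Function.comp_apply, smul_eq_mul, mulVec, dotProduct, map_apply] at this
  simpa [mulVec, dotProduct] using this

theorem exists_mulVec_eq_of_mem_mul {ι κ : Type*} [Fintype ι] [DecidableEq ι] [Fintype κ]
    {A : Matrix ι κ R} {I J : Ideal R} (hJ : J ≤ A.cokerAnnihilator) {b : ι → R}
    (hb : ∀ i, b i ∈ I * J) : ∃ w : κ → R, (∀ l, w l ∈ I) ∧ b = A *ᵥ w := by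
  have hsingle : ∀ i, ∀ x ∈ I * J, ∃ w : κ → R, (∀ l, w l ∈ I) ∧ Pi.single i x = A *ᵥ w := by
    intro i x hx
    induction hx using Submodule.mul_induction_on' with
    | mem_mul_mem s hs t ht =>
      obtain ⟨w, hw⟩ := hJ ht (Pi.single i 1)
      refine ⟨s • w, fun l => I.mul_mem_right _ hs, ?_⟩
      rw [mulVec_smul, ← hw, ← Pi.single_smul, ← Pi.single_smul]
      simp
    | add x _ y _ hx hy =>
      obtain ⟨u, hu, hu'⟩ := hx
      obtain ⟨w, hw, hw'⟩ := hy
      exact ⟨u + w, fun l => I.add_mem (hu l) (hw l), by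
        rw [Pi.single_add, hu', hw', mulVec_add]⟩
  choose w hw hw' using fun i => hsingle i (b i) (hb i)
  refine ⟨∑ i, w i, fun l => ?_, ?_⟩
  · rw [Finset.sum_apply]
    exact I.sum_mem fun i _ => hw i l
  · rw [mulVec_sum, ← Finset.univ_sum_single b]
    exact Finset.sum_congr rfl fun i _ => by simpa using hw' i

theorem isUnit_one_add_of_mem_maximalIdeal [IsLocalRing R] {κ : Type*} [Fintype κ] [DecidableEq κ]
    {W : Matrix κ κ R} (hW : ∀ i l, W i l ∈ maximalIdeal R) : IsUnit (1 + W) := by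
  rw [isUnit_iff_isUnit_det, ← isUnit_map_iff (residue R), RingHom.map_det]
  have : (residue R).mapMatrix (1 + W) = 1 := by
    rw [map_add, map_one, add_eq_left]
    ext i l
    simpa [residue_eq_zero_iff] using hW i l
  simp [this]

end Matrix

/-- Over a henselian Noetherian local `k`-algebra with `dim R ≤ n - m + 1`
(and `m ≤ n`), a matrix `A ∈ Mat(m,n;𝔪)` is finitely-`𝒢_{lr}`-determined iff it is
finitely-`G_r`-determined. -/
theorem finite_cGlr_determined_iff_finite_Gr_determined
    {k R : Type*} [Field k] [CharZero k] [CommRing R] [Algebra k R]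
    [IsNoetherianRing R] [IsLocalRing R] [HenselianLocalRing R]
    {m n : ℕ} (hmn : m ≤ n)
    (hdim : ringKrullDim R ≤ ((n - m + 1 : ℕ) : WithBot ℕ∞))
    (A : Matrix (Fin m) (Fin n) R)
    (hA : ∀ i j, A i j ∈ maximalIdeal R) :
    (∃ k₀ : ℕ, ∀ B : Matrix (Fin m) (Fin n) R,
        (∀ i j, B i j ∈ (maximalIdeal R) ^ (k₀ + 1)) →
        ∃ (U : Matrix (Fin m) (Fin m) R) (V : Matrix (Fin n) (Fin n) R)
          (φ : R ≃ₐ[k] R),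
          IsUnit U ∧ IsUnit V ∧ A + B = U * (A.map φ) * V) ↔
    (∃ k₀ : ℕ, ∀ B : Matrix (Fin m) (Fin n) R,
        (∀ i j, B i j ∈ (maximalIdeal R) ^ (k₀ + 1)) →
        ∃ V : Matrix (Fin n) (Fin n) R, IsUnit V ∧ A + B = A * V) := by
  constructor
  · rintro ⟨k₀, h⟩
    have : Infinite k := Infinite.of_injective _ (Nat.cast_injective (R := k))
    obtain ⟨B, hB, hmin⟩ := Matrix.exists_add_minorIdeal k (maximalIdeal R ^ (k₀ + 1)) A
    obtain ⟨U, V, φ, hU, -, hUV⟩ := h B hB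
    have hrad : maximalIdeal R ≤ ((A + B).minorIdeal m n).radical := by
      rw [Ideal.radical_eq_sInf]
      refine le_sInf ?_
      rintro p ⟨hle, hp⟩
      by_contra hne
      have hlt : p < maximalIdeal R :=
        lt_of_le_of_ne (le_maximalIdeal hp.ne_top) fun h => hne h.ge
      refine hmin p (fun h => hne (hp.le_of_pow_le h)) m le_rfl ?_ hle
      have h1 : p.height + 1 ≤ ((n - m + 1 : ℕ) : ℕ∞) := by
        refine (Ideal.height_add_one_le_of_lt_of_isPrime hlt).trans ?_
        rw [← maximalIdeal_height_eq_ringKrullDim] at hdim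
        exact WithBot.coe_le_coe.1 hdim
      have h2 : p.height ≤ ((n - m : ℕ) : ℕ∞) := by
        push_cast at h1
        exact (ENat.add_le_add_iff_right ENat.one_ne_top).1 (by exact_mod_cast h1)
      calc p.height + (m : ℕ∞) ≤ ((n - m : ℕ) : ℕ∞) + m := by gcongr
        _ = n := by rw [← Nat.cast_add, Nat.sub_add_cancel hmn]
    obtain ⟨N, hN⟩ := Ideal.exists_pow_le_of_le_radical_of_fg hrad
      (IsNoetherian.noetherian (maximalIdeal R))
    have hA' : maximalIdeal R ^ N ≤ A.cokerAnnihilator :=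
      Matrix.pow_maximalIdeal_le_cokerAnnihilator_of_equiv φ.toRingEquiv hU hUV
        (hN.trans (Matrix.minorIdeal_le_cokerAnnihilator _ _))
    refine ⟨N, fun B hB => ?_⟩
    choose w hw hBw using fun l => Matrix.exists_mulVec_eq_of_mem_mul (b := B.col l) hA'
      (fun i => by rw [← pow_succ']; exact hB i l)
    refine ⟨1 + (Matrix.of w).transpose,
      Matrix.isUnit_one_add_of_mem_maximalIdeal fun i l => hw l i, ?_⟩
    rw [Matrix.mul_add, Matrix.mul_one, add_right_inj]
    ext i l
    exact congrFun (hBw l) i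
  · rintro ⟨k₀, h⟩
    refine ⟨k₀, fun B hB => ?_⟩
    obtain ⟨V, hV, hAV⟩ := h B hB
    exact ⟨1, V, AlgEquiv.refl, isUnit_one, hV, by simpa using hAV⟩
end

section
/- Let k be a field of characteristic zero, (R,𝔪) a Noetherian local k-algebra, m ≥ 2, and A ∈ Mat(m,m;𝔪) an antisymmetric matrix (Aᵀ = -A). Then A is finitely-G_congr-determined inside antisymmetric matrices if and only if there exists N ∈ ℕ with 𝔪^N ⊆ I_{m-1}(A). -/
open IsLocalRing

section

open Matrix

theorem Matrix.exists_mul_eq_adjugate_smul_sub {ι R : Type*} [Fintype ι] [DecidableEq ι]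
    [CommRing R] (A : Matrix ι ι R) (k : ι) :
    ∃ Z : Matrix ι ι R,
      A * Z = A.adjugate k k • (1 : Matrix ι ι R) -
        vecMulVec (Pi.single k 1) (A.adjugate k) := by
  set H := A.updateRow k (Pi.single k 1) with hH
  have hdet : H.det = A.adjugate k k := (adjugate_apply A k k).symm
  refine ⟨of fun i j => if j = k then 0 else H.adjugate i j, ?_⟩
  ext i j
  simp only [mul_apply, of_apply, sub_apply, smul_apply, smul_eq_mul, vecMulVec_apply]
  by_cases hj : j = k
  · subst hj
    by_cases hi : i = j
    · subst hi; simp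
    · simp [hi]
  · simp only [hj, if_false]
    by_cases hi : i = k
    · subst hi
      have h1 := det_eq_sum_mul_adjugate_row (H.updateRow j (A i)) j
      simp only [updateRow_self] at h1
      have h2 : ∀ l, (H.updateRow j (A i)).adjugate l j = H.adjugate l j := fun l => by
        simp [adjugate_apply]
      simp only [h2] at h1
      rw [← h1, adjugate_apply A i j]
      have h3 : H.updateRow j (A i) =
          (A.updateRow j (Pi.single i 1)).submatrix (Equiv.swap i j) id := by
        ext a b
        simp only [submatrix_apply, id, hH]
        by_cases ha : a = j
        · subst ha; simp [Ne.symm hj]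
        · by_cases ha' : a = i
          · subst ha'; simp [Ne.symm hj]
          · rw [Equiv.swap_apply_of_ne_of_ne ha' ha]; simp [ha, ha']
      rw [h3, det_permute, Equiv.Perm.sign_swap (Ne.symm hj)]
      simp [Ne.symm hj]
    · have h := congrFun (congrFun (mul_adjugate H) i) j
      simp only [mul_apply, hdet] at h
      have : ∀ l, H i l = A i l := fun l => by simp [hH, hi]
      simp only [this] at h
      rw [h]; simp [hi]

theorem Matrix.isSquare_det_of_transpose_eq_neg {K : Type*} [Field K] (h2 : (2 : K) ≠ 0) :
    ∀ {n : ℕ} (A : Matrix (Fin n) (Fin n) K), Aᵀ = -A → IsSquare A.det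
  | 0, A, _ => by simp
  | 1, A, hA => by
    have h := congrFun (congrFun hA 0) 0
    simp only [transpose_apply, neg_apply] at h
    have : A 0 0 = 0 := by
      have : 2 * A 0 0 = 0 := by linear_combination h
      simpa [h2] using this
    simp [this]
  | n + 2, A, hA => by
    have hneg : ∀ i j, A j i = -A i j := fun i j => congrFun (congrFun hA i) j
    have hdiag : ∀ i, A i i = 0 := fun i => by
      have : 2 * A i i = 0 := by linear_combination hneg i i
      simpa [h2] using this
    by_cases h0 : ∀ j, A 0 j = 0
    · rw [det_eq_zero_of_row_eq_zero 0 h0]; exact IsSquare.zero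
    push Not at h0
    obtain ⟨j, hj⟩ := h0
    have hj0 : j ≠ 0 := by rintro rfl; exact hj (hdiag 0)
    let e : Fin 2 ⊕ Fin n ≃ Fin (n + 2) :=
      (finSumFinEquiv.trans (finCongr (add_comm 2 n))).trans (Equiv.swap 1 j)
    have e0 : e (Sum.inl 0) = 0 := by
      have : (finCongr (add_comm 2 n)) (finSumFinEquiv (Sum.inl (0 : Fin 2))) = 0 := by
        ext; simp
      simp only [e, Equiv.trans_apply, this]
      exact Equiv.swap_apply_of_ne_of_ne (by simp) hj0.symm
    have e1 : e (Sum.inl 1) = j := by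
      have : (finCongr (add_comm 2 n)) (finSumFinEquiv (Sum.inl (1 : Fin 2))) = 1 := by
        ext; simp
      simp only [e, Equiv.trans_apply, this]
      exact Equiv.swap_apply_left _ _
    set M := A.submatrix e e with hM
    have hMt : ∀ x y, M y x = -M x y := fun x y => hneg _ _
    have hdetM : A.det = M.det := (det_submatrix_equiv_self e A).symm
    have hblock := fromBlocks_toBlocks M
    have h11 : M.toBlocks₁₁ = !![0, A 0 j; -A 0 j, 0] := by
      ext a b
      fin_cases a <;> fin_cases b <;>
        simp [toBlocks₁₁, hM, e0, e1, hdiag, hneg 0 j]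
    have hdet11 : M.toBlocks₁₁.det = A 0 j * A 0 j := by
      rw [h11, det_fin_two_of]; ring
    have : Invertible M.toBlocks₁₁ :=
      invertibleOfIsUnitDet _ (by rw [hdet11]; exact (mul_ne_zero hj hj).isUnit)
    have h11t : M.toBlocks₁₁ᵀ = -M.toBlocks₁₁ := by ext a b; exact hMt _ _
    have h22t : M.toBlocks₂₂ᵀ = -M.toBlocks₂₂ := by ext a b; exact hMt _ _
    have h12t : M.toBlocks₁₂ᵀ = -M.toBlocks₂₁ := by ext a b; exact hMt _ _
    have h21t : M.toBlocks₂₁ᵀ = -M.toBlocks₁₂ := by ext a b; exact hMt _ _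
    have hinv : (⅟M.toBlocks₁₁)ᵀ = -⅟M.toBlocks₁₁ := by
      rw [invOf_eq_nonsing_inv, transpose_nonsing_inv, h11t]
      refine inv_eq_left_inv ?_
      simp
    rw [hdetM, ← hblock, det_fromBlocks₁₁, hdet11]
    refine IsSquare.mul ⟨_, rfl⟩ (isSquare_det_of_transpose_eq_neg h2 _ ?_)
    rw [transpose_sub, transpose_mul, transpose_mul, h22t, h12t, h21t, hinv]
    simp only [Matrix.neg_mul, Matrix.mul_neg, Matrix.mul_assoc]
    abel

theorem Matrix.transpose_adjugate_of_transpose_eq_neg {ι R : Type*} [Fintype ι] [DecidableEq ι]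
    [CommRing R] {A : Matrix ι ι R} (hA : Aᵀ = -A) :
    A.adjugateᵀ = (-1 : R) ^ (Fintype.card ι - 1) • A.adjugate := by
  rw [adjugate_transpose, hA, ← neg_one_smul R A, adjugate_smul]

/-- The generic alternating matrix. -/
noncomputable def genericAlternating (n : ℕ) :
    Matrix (Fin n) (Fin n) (MvPolynomial (Fin n × Fin n) ℤ) :=
  of fun i j => MvPolynomial.X (i, j) - MvPolynomial.X (j, i)

theorem genericAlternating_transpose (n : ℕ) :
    (genericAlternating n)ᵀ = -genericAlternating n := by
  ext1 i j
  simp [genericAlternating]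

theorem adjugate_genericAlternating_self_ne_zero {n : ℕ} (hn : Even n) (k : Fin (n + 1)) :
    (genericAlternating (n + 1)).adjugate k k ≠ 0 := by
  let φ : MvPolynomial (Fin (n + 1) × Fin (n + 1)) ℤ →+* ZMod 2 :=
    MvPolynomial.eval₂Hom (Int.castRingHom _) (fun p => if p.1 < p.2 then 1 else 0)
  have hφ : φ.mapMatrix (genericAlternating (n + 1)) =
      of fun i j => if i = j then (0 : ZMod 2) else 1 := by
    ext i j
    simp only [genericAlternating, RingHom.mapMatrix_apply, map_apply, of_apply, map_sub, φ,
      MvPolynomial.eval₂Hom_X']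
    rcases lt_trichotomy i j with h | h | h
    · simp [h, h.not_gt, h.ne]
    · simp [h]
    · simp [h, h.not_gt, h.ne', ZMod.neg_eq_self_mod_two]
  intro h0
  have h1 := congrArg φ h0
  rw [← map_apply (f := φ), ← RingHom.mapMatrix_apply, RingHom.map_adjugate, hφ,
    adjugate_fin_succ_eq_det_submatrix, map_zero] at h1
  set E : Matrix (Fin n) (Fin n) (ZMod 2) :=
    (of fun i j : Fin (n + 1) => if i = j then (0 : ZMod 2) else 1).submatrix
      k.succAbove k.succAbove with hE
  have hE1 : E = of (fun _ _ => (1 : ZMod 2)) + 1 := by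
    ext i j
    by_cases hij : i = j
    · subst hij; simp [hE]; decide
    · simp [hE, hij]
  have hsq : E * E = 1 := by
    have hJ : (of (fun _ _ => (1 : ZMod 2)) : Matrix (Fin n) (Fin n) (ZMod 2)) *
        of (fun _ _ => (1 : ZMod 2)) = 0 := by
      ext i j
      simp [mul_apply, (ZMod.natCast_eq_zero_iff_even).2 hn]
    rw [hE1, add_mul, mul_add, hJ, mul_one, one_mul, zero_add, ← add_assoc]
    have : ∀ M : Matrix (Fin n) (Fin n) (ZMod 2), M + M = 0 := fun M => by
      ext i j; exact CharTwo.add_self_eq_zero _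
    rw [this, zero_add]
  have hd : E.det = 0 := by
    rcases mul_eq_zero.1 h1 with h | h
    · exact absurd h (pow_ne_zero _ (by decide))
    · exact h
  have := congrArg det hsq
  rw [det_mul, hd, det_one, zero_mul] at this
  exact zero_ne_one this

theorem det_eq_zero_of_transpose_eq_neg {ι R : Type*} [Fintype ι] [DecidableEq ι]
    [CommRing R] (h2 : ∀ x : R, 2 * x = 0 → x = 0) (hι : Odd (Fintype.card ι))
    {A : Matrix ι ι R} (hA : Aᵀ = -A) : A.det = 0 := by
  have h := congrArg det hA
  rw [det_transpose, det_neg, hι.neg_one_pow] at h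
  exact h2 _ (by linear_combination h)

/-- The vector of sub-maximal Pfaffians of the generic alternating matrix of odd size. -/
theorem exists_generic_pfaffians {n : ℕ} (hn : Even n) :
    ∃ v : Fin (n + 1) → MvPolynomial (Fin (n + 1) × Fin (n + 1)) ℤ,
      (genericAlternating (n + 1)).adjugate = vecMulVec v v ∧
      genericAlternating (n + 1) *ᵥ v = 0 := by
  let S := MvPolynomial (Fin (n + 1) × Fin (n + 1)) ℤ
  set G : Matrix (Fin (n + 1)) (Fin (n + 1)) S := genericAlternating (n + 1) with hG
  set P := G.adjugate with hP
  have hGt : Gᵀ = -G := genericAlternating_transpose _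
  have hP0 : ∀ k, P k k ≠ 0 := adjugate_genericAlternating_self_ne_zero hn
  have h2 : ∀ x : S, 2 * x = 0 → x = 0 := fun x hx => by simpa using hx
  have hdet : G.det = 0 :=
    det_eq_zero_of_transpose_eq_neg h2 (by simpa using hn.add_one) hGt
  have hPt : ∀ i j, P j i = P i j := fun i j => by
    have := congrFun (congrFun (transpose_adjugate_of_transpose_eq_neg hGt) i) j
    simpa [hn.neg_one_pow] using this
  have hrank : ∀ k i j, P k k * P i j = P i k * P k j := fun k i j => by
    obtain ⟨Z, hZ⟩ := exists_mul_eq_adjugate_smul_sub G k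
    have h := congrArg (P * ·) hZ
    simp only [← Matrix.mul_assoc] at h
    rw [hP, adjugate_mul, hdet, zero_smul, Matrix.zero_mul, ← hP, Matrix.mul_sub] at h
    have h := congrFun (congrFun h i) j
    simp only [mul_vecMulVec] at h
    simp [vecMulVec_apply] at h
    linear_combination -h
  have hsq : IsSquare (algebraMap S (FractionRing S) (P 0 0)) := by
    have : algebraMap S (FractionRing S) (P 0 0) =
        (((algebraMap S (FractionRing S)).mapMatrix G).submatrix
          (Fin.succAbove 0) (Fin.succAbove 0)).det := by
      rw [hP, adjugate_fin_succ_eq_det_submatrix, RingHom.mapMatrix_apply, submatrix_map,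
        ← RingHom.mapMatrix_apply, ← RingHom.map_det]
      simp
    rw [this]
    refine isSquare_det_of_transpose_eq_neg ?_ _ ?_
    · intro h
      have : algebraMap S (FractionRing S) 2 = algebraMap S (FractionRing S) 0 := by
        rw [map_zero, ← h]; exact map_ofNat _ 2
      exact two_ne_zero (IsFractionRing.injective S (FractionRing S) this)
    · ext i j
      have := congrFun (congrFun hGt i.succ) j.succ
      simp only [transpose_apply, Matrix.neg_apply] at this
      simp [this]
  obtain ⟨q, hq⟩ := hsq
  obtain ⟨p, rfl⟩ : ∃ p : S, algebraMap S (FractionRing S) p = q :=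
    IsIntegrallyClosed.exists_algebraMap_eq_of_isIntegral_pow two_pos
      (by rw [sq, ← hq]; exact isIntegral_algebraMap)
  have hp : P 0 0 = p * p :=
    IsFractionRing.injective S (FractionRing S) (by rw [hq, map_mul])
  have hp0 : p ≠ 0 := by rintro rfl; exact hP0 0 (by simp [hp])
  have hdvd : ∀ j, p ∣ P 0 j := fun j => by
    refine (IsIntegrallyClosed.pow_dvd_pow_iff two_ne_zero).1 ⟨P j j, ?_⟩
    have := hrank 0 j j
    rw [hp, hPt 0 j] at this
    linear_combination -this
  choose v hv using hdvd
  have hPv : ∀ i j, P i j = v i * v j := fun i j => by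
    have := hrank 0 i j
    rw [hp, hPt 0 i, hv i, hv j] at this
    exact mul_left_cancel₀ (mul_ne_zero hp0 hp0) (by linear_combination this)
  refine ⟨v, by ext1 i j; exact hPv i j, ?_⟩
  ext1 i
  have hv0 : v 0 ≠ 0 := fun h => hP0 0 (by rw [hPv, h, zero_mul])
  have h := congrFun (congrFun (mul_adjugate G) i) 0
  rw [hdet, zero_smul, ← hP, mul_apply] at h
  simp only [hPv, ← mul_assoc, ← Finset.sum_mul] at h
  exact (mul_eq_zero.1 h).resolve_right hv0

/-- A choice of sub-maximal Pfaffians of antisymmetric matrices of odd size, compatible with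
congruences modulo ideals. -/
theorem exists_pfaffians {R : Type*} [CommRing R] (h2 : IsUnit (2 : R)) {n : ℕ} (hn : Even n) :
    ∃ V : Matrix (Fin (n + 1)) (Fin (n + 1)) R → Fin (n + 1) → R,
      (∀ A, Aᵀ = -A → A.adjugate = vecMulVec (V A) (V A) ∧ A *ᵥ V A = 0) ∧
      ∀ (I : Ideal R) (A B), (∀ i j, B i j ∈ I) → ∀ i, V (A + B) i - V A i ∈ I := by
  obtain ⟨v, hv, hv0⟩ := exists_generic_pfaffians hn
  obtain ⟨c, hc⟩ := h2.exists_left_inv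
  let φ : Matrix (Fin (n + 1)) (Fin (n + 1)) R →
      MvPolynomial (Fin (n + 1) × Fin (n + 1)) ℤ →+* R :=
    fun A => MvPolynomial.eval₂Hom (Int.castRingHom R) (fun p => c * A p.1 p.2)
  refine ⟨fun A i => φ A (v i), fun A hA => ?_, fun I A B hB i => ?_⟩
  · have hφ : (φ A).mapMatrix (genericAlternating (n + 1)) = A := by
      ext i j
      have := congrFun (congrFun hA i) j
      simp only [transpose_apply, Matrix.neg_apply] at this
      simp only [genericAlternating, RingHom.mapMatrix_apply, map_apply, of_apply, map_sub, φ,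
        MvPolynomial.eval₂Hom_X']
      linear_combination (A i j) * hc - c * this
    constructor
    · rw [← hφ, ← RingHom.map_adjugate, hv, hφ]
      ext i j
      simp [vecMulVec_apply]
    · ext i
      have := congrArg (φ A) (congrFun hv0 i)
      rw [RingHom.map_mulVec] at this
      rw [← RingHom.mapMatrix_apply, hφ] at this
      exact this.trans (map_zero _)
  · rw [← Ideal.Quotient.eq]
    have : (Ideal.Quotient.mk I).comp (φ (A + B)) = (Ideal.Quotient.mk I).comp (φ A) := by
      refine MvPolynomial.ringHom_ext (fun r => by simp [φ]) fun p => ?_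
      simp [φ, Ideal.Quotient.eq_zero_iff_mem.2 (hB p.1 p.2)]
    exact congrArg (fun f => f (v i)) this

/-- `B` is congruent to `A`, i.e. `B = U A Uᵀ` with `U` invertible. -/
def MatrixCongruent {ι R : Type*} [Fintype ι] [DecidableEq ι] [CommRing R]
    (A B : Matrix ι ι R) : Prop :=
  ∃ U : Matrix ι ι R, IsUnit U ∧ B = U * A * Uᵀ

namespace MatrixCongruent

variable {ι R : Type*} [Fintype ι] [DecidableEq ι] [CommRing R] {A B C : Matrix ι ι R}

theorem refl (A : Matrix ι ι R) : MatrixCongruent A A :=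
  ⟨1, isUnit_one, by simp⟩

theorem trans (h₁ : MatrixCongruent A B) (h₂ : MatrixCongruent B C) : MatrixCongruent A C := by
  obtain ⟨U, hU, rfl⟩ := h₁
  obtain ⟨V, hV, rfl⟩ := h₂
  exact ⟨V * U, hV.mul hU, by simp only [transpose_mul, Matrix.mul_assoc]⟩

theorem symm (h : MatrixCongruent A B) : MatrixCongruent B A := by
  obtain ⟨U, hU, rfl⟩ := h
  have hd := (isUnit_iff_isUnit_det U).1 hU
  refine ⟨U⁻¹, (isUnit_nonsing_inv_iff).2 hU, ?_⟩
  rw [transpose_nonsing_inv, Matrix.mul_assoc U, nonsing_inv_mul_cancel_left _ _ hd,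
    mul_nonsing_inv_cancel_right _ _ (by rwa [det_transpose])]

end MatrixCongruent

theorem Matrix.mul_apply_mem {ι R : Type*} [Fintype ι] [CommRing R] {I : Ideal R}
    {A : Matrix ι ι R} (hA : ∀ i j, A i j ∈ I) (X : Matrix ι ι R) (i j : ι) :
    (A * X) i j ∈ I := by
  rw [mul_apply]
  exact I.sum_mem fun l _ => I.mul_mem_right _ (hA i l)

theorem Matrix.mul_apply_mem' {ι R : Type*} [Fintype ι] [CommRing R] {I : Ideal R}
    {A : Matrix ι ι R} (hA : ∀ i j, A i j ∈ I) (X : Matrix ι ι R) (i j : ι) :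
    (X * A) i j ∈ I := by
  rw [mul_apply]
  exact I.sum_mem fun l _ => I.mul_mem_left _ (hA l j)

section LocalRing

variable {ι R : Type*} [Fintype ι] [DecidableEq ι] [CommRing R] [IsLocalRing R]

theorem Matrix.isUnit_one_add_of_mem_maximalIdeal_s11 {C : Matrix ι ι R}
    (hC : ∀ i j, C i j ∈ maximalIdeal R) : IsUnit (1 + C) := by
  rw [isUnit_iff_isUnit_det, ← residue_ne_zero_iff_isUnit, RingHom.map_det]
  have : (residue R).mapMatrix (1 + C) = 1 := by
    rw [map_add, map_one]
    convert add_zero _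
    ext i j
    exact (residue_eq_zero_iff _).2 (hC i j)
  rw [this, det_one]
  exact one_ne_zero

theorem MatrixCongruent.add_mul_sum_mul (h2 : IsUnit (2 : R)) :
    ∀ {N : ℕ} (u w : Fin N → ι → R) {A : Matrix ι ι R}, Aᵀ = -A →
      (∀ i j, A i j ∈ maximalIdeal R) →
      MatrixCongruent A
        (A + A * (∑ t, (vecMulVec (u t) (w t) - vecMulVec (w t) (u t))) * A)
  | 0, u, w, A, _, _ => by simpa using MatrixCongruent.refl A
  | N + 1, u, w, A, hA, hAm => by
    set K := vecMulVec (u 0) (w 0) with hK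
    have hKt : vecMulVec (w 0) (u 0) = Kᵀ := by rw [hK, transpose_vecMulVec]
    set Y := ∑ t : Fin N, (vecMulVec (u t.succ) (w t.succ) - vecMulVec (w t.succ) (u t.succ))
      with hY
    have hKAK : K * A * Kᵀ = 0 := by
      have h0 : w 0 ⬝ᵥ A *ᵥ w 0 = 0 := by
        have h := dotProduct_mulVec (w 0) A (w 0)
        rw [← mulVec_transpose, hA, neg_mulVec, neg_dotProduct,
          dotProduct_comm (A *ᵥ w 0)] at h
        have h' : 2 * (w 0 ⬝ᵥ A *ᵥ w 0) = 0 := by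
          linear_combination h
        exact (h2.mul_right_eq_zero).1 h'
      rw [hK, transpose_vecMulVec, vecMulVec_mul, vecMulVec_mul_vecMulVec, ← dotProduct_mulVec,
        h0, zero_smul]
      simp
    set E := K - Kᵀ with hE
    have hEt : Eᵀ = -E := by rw [hE, transpose_sub, transpose_transpose, neg_sub]
    set A₁ := A + A * E * A with hA₁
    have hstep : MatrixCongruent A A₁ := by
      refine ⟨1 + A * K, isUnit_one_add_of_mem_maximalIdeal_s11 (mul_apply_mem hAm K), ?_⟩
      rw [transpose_add, transpose_one, transpose_mul, hA, hA₁, hE]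
      calc A + A * (K - Kᵀ) * A = A + A * (K - Kᵀ) * A - A * (K * A * Kᵀ) * A := by
            rw [hKAK]; simp
        _ = _ := by noncomm_ring
    have hA₁t : A₁ᵀ = -A₁ := by
      rw [hA₁, transpose_add, transpose_mul, transpose_mul, hA, hEt]
      noncomm_ring
    have hA₁m : ∀ i j, A₁ i j ∈ maximalIdeal R := fun i j =>
      add_mem (hAm i j) (mul_apply_mem' hAm _ i j)
    set W := 1 + E * A with hW
    have hWd : IsUnit W.det := (isUnit_iff_isUnit_det _).1
      (isUnit_one_add_of_mem_maximalIdeal_s11 (mul_apply_mem' hAm E))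
    have h1 : A = A₁ * W⁻¹ := by
      have : A₁ = A * W := by rw [hA₁, hW]; noncomm_ring
      rw [this, mul_nonsing_inv_cancel_right _ _ hWd]
    have h1t : A = W⁻¹ᵀ * A₁ := by
      have := congrArg transpose h1
      rw [transpose_mul, hA, hA₁t, Matrix.mul_neg] at this
      exact neg_injective this
    have hfin := add_mul_sum_mul h2 (fun t => W⁻¹ *ᵥ u t.succ) (fun t => W⁻¹ *ᵥ w t.succ)
      hA₁t hA₁m
    have hsum : ∑ t : Fin N, (vecMulVec (W⁻¹ *ᵥ u t.succ) (W⁻¹ *ᵥ w t.succ) -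
        vecMulVec (W⁻¹ *ᵥ w t.succ) (W⁻¹ *ᵥ u t.succ)) = W⁻¹ * Y * W⁻¹ᵀ := by
      rw [hY, Matrix.mul_sum, Matrix.sum_mul]
      refine Finset.sum_congr rfl fun t _ => ?_
      simp only [Matrix.mul_sub, Matrix.sub_mul, mul_vecMulVec, vecMulVec_mul, vecMul_transpose]
    rw [hsum] at hfin
    refine hstep.trans ?_
    convert hfin using 1
    rw [Fin.sum_univ_succ, ← hK, hKt, ← hE, ← hY, Matrix.mul_add, Matrix.add_mul, ← add_assoc,
      ← hA₁]
    congr 1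
    conv_lhs => rw [Matrix.mul_assoc]
    conv_lhs =>
      congr
      · rw [h1]
      · rw [h1t]
    simp only [Matrix.mul_assoc]

theorem MatrixCongruent.add_of_eq_mul_mul (h2 : IsUnit (2 : R)) {A B Y : Matrix ι ι R}
    (hA : Aᵀ = -A) (hAm : ∀ i j, A i j ∈ maximalIdeal R) (hB : Bᵀ = -B) (hY : B = A * Y * A) :
    MatrixCongruent A (A + B) := by
  obtain ⟨c, hc⟩ := h2.exists_left_inv
  let e := Fintype.equivFin ι
  have h := MatrixCongruent.add_mul_sum_mul h2
    (fun t => Pi.single (e.symm t) c) (fun t => Y (e.symm t)) hA hAm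
  have hsum : ∑ t, (vecMulVec (Pi.single (e.symm t) c) (Y (e.symm t)) -
      vecMulVec (Y (e.symm t)) (Pi.single (e.symm t) c)) = c • (Y - Yᵀ) := by
    rw [e.symm.sum_comp (fun i => vecMulVec (Pi.single i c) (Y i) -
      vecMulVec (Y i) (Pi.single i c))]
    ext i j
    simp [Matrix.sum_apply, vecMulVec_apply, Pi.single_apply, mul_sub, mul_comm]
  rw [hsum] at h
  have hYt : A * Yᵀ * A = -B := by
    rw [← hB, hY, transpose_mul, transpose_mul, hA]
    noncomm_ring
  convert h using 2
  rw [Matrix.mul_smul, Matrix.smul_mul, Matrix.mul_sub, Matrix.sub_mul, hYt, ← hY, sub_neg_eq_add,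
    ← two_smul R, smul_smul, hc, one_smul]

end LocalRing

theorem fittingIdeal_le_span_adjugate {R : Type*} [CommRing R] {n : ℕ}
    (A : Matrix (Fin (n + 1)) (Fin (n + 1)) R) :
    fittingIdeal n A ≤ Ideal.span (Set.range fun p : Fin (n + 1) × Fin (n + 1) =>
      A.adjugate p.1 p.2) := by
  have key : ∀ f : Fin n → Fin (n + 1), Function.Injective f →
      ∃ (i : Fin (n + 1)) (σ : Equiv.Perm (Fin n)), f = i.succAbove ∘ σ := by
    intro f hf
    obtain ⟨i, hi⟩ : ∃ i, ∀ x, f x ≠ i := by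
      by_contra! h
      have := Fintype.card_le_of_surjective f h
      simp at this
    choose σ hσ using fun x => Fin.exists_succAbove_eq (hi x)
    have hinj : Function.Injective σ := fun x y hxy => hf (by rw [← hσ x, ← hσ y, hxy])
    exact ⟨i, Equiv.ofBijective σ (Finite.injective_iff_bijective.1 hinj),
      funext fun x => (hσ x).symm⟩
  refine Ideal.span_le.2 ?_
  rintro d ⟨f, g, hf, hg, rfl⟩
  obtain ⟨i, σ, rfl⟩ := key f hf
  obtain ⟨j, τ, rfl⟩ := key g hg
  have h1 : (A.submatrix (i.succAbove ∘ σ) (j.succAbove ∘ τ)).det =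
      (Equiv.Perm.sign σ : R) * ((Equiv.Perm.sign τ : R) *
        (A.submatrix i.succAbove j.succAbove).det) := by
    rw [← det_permute', ← det_permute]
    rfl
  have h2 : (A.submatrix i.succAbove j.succAbove).det =
      (-1) ^ (i + j : ℕ) * A.adjugate j i := by
    rw [adjugate_fin_succ_eq_det_submatrix, ← mul_assoc, ← pow_add, Even.neg_one_pow ⟨_, rfl⟩,
      one_mul]
  rw [h1, h2]
  exact Ideal.mul_mem_left _ _ (Ideal.mul_mem_left _ _ (Ideal.mul_mem_left _ _
    (Ideal.subset_span ⟨(j, i), rfl⟩)))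

theorem adjugate_mem_fittingIdeal {R : Type*} [CommRing R] {n : ℕ}
    (A : Matrix (Fin (n + 1)) (Fin (n + 1)) R) (i j : Fin (n + 1)) :
    A.adjugate i j ∈ fittingIdeal n A := by
  rw [adjugate_fin_succ_eq_det_submatrix]
  exact Ideal.mul_mem_left _ _ (Ideal.subset_span
    ⟨_, _, Fin.succAbove_right_injective, Fin.succAbove_right_injective, rfl⟩)

/-- By Artin–Rees, a matrix with entries in a high power of `I` whose rows and columns are
annihilated by `v` is of the form `A * Y * A`. -/
theorem exists_eq_mul_mul_of_mulVec_eq_zero {R : Type*} [CommRing R] [IsNoetherianRing R] {n : ℕ}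
    {A : Matrix (Fin (n + 1)) (Fin (n + 1)) R} {v : Fin (n + 1) → R} (hA : Aᵀ = -A)
    (hv : A.adjugate = vecMulVec v v) {I : Ideal R} {M : ℕ}
    (hM : I ^ M ≤ Ideal.span (Set.range fun k => v k ^ 4)) :
    ∃ L, ∀ X : Matrix (Fin (n + 1)) (Fin (n + 1)) R, X *ᵥ v = 0 → v ᵥ* X = 0 →
      (∀ i j, X i j ∈ I ^ L) → ∃ Y, X = A * Y * A := by
  let K : Submodule R (Matrix (Fin (n + 1)) (Fin (n + 1)) R) :=
    { carrier := {X | X *ᵥ v = 0 ∧ v ᵥ* X = 0}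
      zero_mem' := by simp
      add_mem' := fun ha hb => by
        simp only [Set.mem_ofPred_eq] at ha hb ⊢
        simp [add_mulVec, vecMul_add, ha, hb]
      smul_mem' := fun c X hX => by
        simp only [Set.mem_ofPred_eq] at hX ⊢
        simp [smul_mulVec, vecMul_smul, hX] }
  let T : Submodule R (Matrix (Fin (n + 1)) (Fin (n + 1)) R) :=
    LinearMap.range (LinearMap.mulLeft R A ∘ₗ LinearMap.mulRight R A)
  have hT : Ideal.span (Set.range fun k => v k ^ 4) • K ≤ T := by
    refine Submodule.smul_le.2 fun r hr X hX => ?_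
    have hle : Ideal.span (Set.range fun k => v k ^ 4) ≤
        T.comap (LinearMap.toSpanSingleton R _ X) := by
      refine Ideal.span_le.2 ?_
      rintro _ ⟨k, rfl⟩
      obtain ⟨Z, hZ⟩ := exists_mul_eq_adjugate_smul_sub A k
      have hPk : A.adjugate k = v k • v := by rw [hv]; rfl
      rw [hPk] at hZ
      have h1 : A * Z * X = v k ^ 2 • X := by
        rw [hZ, Matrix.sub_mul, vecMulVec_mul, smul_vecMul, hX.2]
        simp [sq]
      have h2 : X * (Zᵀ * A) = -(v k ^ 2 • X) := by
        have := congrArg transpose hZ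
        rw [transpose_mul, hA, Matrix.mul_neg, transpose_sub, transpose_vecMulVec] at this
        rw [neg_eq_iff_eq_neg.1 this, Matrix.mul_neg, Matrix.mul_sub, mul_vecMulVec, mulVec_smul,
          hX.1]
        simp [sq]
      refine ⟨-(Z * X * Zᵀ), ?_⟩
      simp only [LinearMap.comp_apply, LinearMap.mulLeft_apply, LinearMap.mulRight_apply,
        LinearMap.toSpanSingleton_apply]
      have : A * (-(Z * X * Zᵀ) * A) = -((A * Z * X) * (Zᵀ * A)) := by
        simp only [Matrix.mul_assoc, Matrix.neg_mul, Matrix.mul_neg]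
      rw [this, h1, Matrix.smul_mul, h2, smul_neg, neg_neg, smul_smul]
      congr 1
      ring
    simpa using hle hr
  obtain ⟨c, hc⟩ := I.exists_pow_inf_eq_pow_smul K
  refine ⟨M + c, fun X hX1 hX2 hXm => ?_⟩
  have htop : X ∈ I ^ (M + c) • (⊤ : Submodule R (Matrix (Fin (n + 1)) (Fin (n + 1)) R)) := by
    rw [matrix_eq_sum_single X]
    refine Submodule.sum_mem _ fun i _ => Submodule.sum_mem _ fun j _ => ?_
    have : single i j (X i j) = X i j • single i j (1 : R) := by simp
    rw [this]
    exact Submodule.smul_mem_smul (hXm i j) trivial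
  have hmem : X ∈ I ^ (M + c) • (⊤ : Submodule R _) ⊓ K := ⟨htop, hX1, hX2⟩
  rw [hc _ (Nat.le_add_left c M), Nat.add_sub_cancel] at hmem
  obtain ⟨Y, hY⟩ := hT (Submodule.smul_mono hM inf_le_right hmem)
  exact ⟨Y, by rw [← hY]; simp [Matrix.mul_assoc]⟩

section Determinacy

variable {R : Type*} [CommRing R] [IsNoetherianRing R] [IsLocalRing R] {n : ℕ}
  {A : Matrix (Fin (n + 1)) (Fin (n + 1)) R}

theorem exists_pow_maximalIdeal_le {N : ℕ} {J : Ideal R}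
    (hN : maximalIdeal R ^ N ≤ fittingIdeal n A)
    (hJ : ∀ i j, A.adjugate i j ∈ J.radical) : ∃ M, maximalIdeal R ^ M ≤ J := by
  refine Ideal.exists_pow_le_of_le_radical_of_fg ?_ (IsNoetherian.noetherian _)
  have h : maximalIdeal R ^ N ≤ J.radical :=
    (hN.trans (fittingIdeal_le_span_adjugate A)).trans
      (Ideal.span_le.2 (by rintro _ ⟨p, rfl⟩; exact hJ _ _))
  intro x hx
  exact Ideal.radical_idem J ▸ ⟨N, h (Ideal.pow_mem_pow hx N)⟩

theorem exists_congruent_of_odd (h2 : IsUnit (2 : R)) (hn : Odd n) (hA : Aᵀ = -A)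
    (hAm : ∀ i j, A i j ∈ maximalIdeal R) {N : ℕ} (hN : maximalIdeal R ^ N ≤ fittingIdeal n A) :
    ∃ K : ℕ, ∀ B : Matrix (Fin (n + 1)) (Fin (n + 1)) R, Bᵀ = -B →
      (∀ i j, B i j ∈ maximalIdeal R ^ (K + 1)) → MatrixCongruent A (A + B) := by
  have hP : ∀ i j, A.adjugate j i = -A.adjugate i j := fun i j => by
    have := congrFun (congrFun (transpose_adjugate_of_transpose_eq_neg hA) i) j
    simpa [hn.neg_one_pow] using this
  have hP0 : ∀ i, A.adjugate i i = 0 := fun i =>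
    h2.mul_right_eq_zero.1 (by linear_combination hP i i)
  obtain ⟨M, hM⟩ := exists_pow_maximalIdeal_le (J := Ideal.span {A.det ^ 2}) hN fun i j => by
    obtain ⟨Z, hZ⟩ := exists_mul_eq_adjugate_smul_sub A j
    have h := congrArg (A.adjugate * ·) hZ
    simp only [← Matrix.mul_assoc] at h
    rw [adjugate_mul, hP0, zero_smul, zero_sub, Matrix.mul_neg, mul_vecMulVec] at h
    have h := congrFun (congrFun h i) i
    simp [vecMulVec_apply] at h
    refine ⟨4, Ideal.mem_span_singleton.2 ⟨Z i i ^ 2, ?_⟩⟩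
    rw [hP i j] at h
    linear_combination (-A.det * Z i i - A.adjugate i j ^ 2) * h
  refine ⟨M, fun B hB hBm => ?_⟩
  choose C hC using fun i j =>
    Ideal.mem_span_singleton.1 (hM (Ideal.pow_le_pow_right (Nat.le_succ M) (hBm i j)))
  refine MatrixCongruent.add_of_eq_mul_mul h2 (Y := A.adjugate * of C * A.adjugate) hA hAm hB ?_
  have : A * (A.adjugate * of C * A.adjugate) * A =
      (A * A.adjugate) * of C * (A.adjugate * A) := by simp only [Matrix.mul_assoc]
  rw [this, mul_adjugate, adjugate_mul]
  ext i j
  simp [hC]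
  ring

theorem exists_congruent_of_even (h2 : IsUnit (2 : R)) (hn : Even n) (hA : Aᵀ = -A)
    (hAm : ∀ i j, A i j ∈ maximalIdeal R) {N : ℕ} (hN : maximalIdeal R ^ N ≤ fittingIdeal n A) :
    ∃ K : ℕ, ∀ B : Matrix (Fin (n + 1)) (Fin (n + 1)) R, Bᵀ = -B →
      (∀ i j, B i j ∈ maximalIdeal R ^ (K + 1)) → MatrixCongruent A (A + B) := by
  obtain ⟨V, hV, hVB⟩ := exists_pfaffians h2 hn
  obtain ⟨hadj, hAv⟩ := hV A hA
  obtain ⟨M, hM⟩ := exists_pow_maximalIdeal_le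
    (J := Ideal.span (Set.range fun k => V A k ^ 4)) hN fun i j => by
      rw [hadj, vecMulVec_apply]
      have h : V A i ^ 4 ∈ Ideal.span (Set.range fun k => V A k ^ 4) :=
        Ideal.subset_span ⟨i, rfl⟩
      refine ⟨4, ?_⟩
      rw [mul_pow]
      exact Ideal.mul_mem_right _ _ h
  obtain ⟨L, hL⟩ := exists_eq_mul_mul_of_mulVec_eq_zero hA hadj hM
  have hMv : maximalIdeal R ^ M ≤ Ideal.span (Set.range (V A)) := by
    refine hM.trans (Ideal.span_le.2 ?_)
    rintro _ ⟨k, rfl⟩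
    have h : V A k ∈ Ideal.span (Set.range (V A)) := Ideal.subset_span ⟨k, rfl⟩
    exact Ideal.pow_mem_of_mem _ h 4 (by norm_num)
  refine ⟨L + 1 + M, fun B hB hBm => ?_⟩
  have hABt : (A + B)ᵀ = -(A + B) := by rw [transpose_add, hA, hB, neg_add]
  obtain ⟨-, hABv⟩ := hV (A + B) hABt
  have hC : ∀ i, ∃ c : Fin (n + 1) → R, (∀ j, c j ∈ maximalIdeal R ^ (L + 1)) ∧
      ∑ j, c j * V A j = V (A + B) i - V A i := fun i => by
    have h : V (A + B) i - V A i ∈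
        maximalIdeal R ^ (L + 1) • Ideal.span (Set.range (V A)) := by
      have := Ideal.pow_le_pow_right (Nat.le_succ _) (hVB _ A B hBm i)
      rw [pow_add] at this
      exact Ideal.mul_mono_right hMv this
    obtain ⟨a, ha, hsum⟩ := (Submodule.mem_ideal_smul_span_iff_exists_sum _ _ _).1 h
    refine ⟨a, ha, ?_⟩
    rw [← hsum, Finsupp.sum_fintype _ _ (by simp)]
    rfl
  choose C hCm hCv using hC
  set U : Matrix (Fin (n + 1)) (Fin (n + 1)) R := 1 + of C with hU
  have hUv : U *ᵥ V A = V (A + B) := by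
    ext i
    rw [hU, add_mulVec, one_mulVec, Pi.add_apply]
    change V A i + ∑ j, C i j * V A j = _
    rw [hCv, add_sub_cancel]
  have hUu : IsUnit U := isUnit_one_add_of_mem_maximalIdeal_s11 fun i j =>
    Ideal.pow_le_self (Nat.succ_ne_zero L) (hCm i j)
  set X := Uᵀ * (A + B) * U - A with hX
  have hXt : Xᵀ = -X := by
    rw [hX, transpose_sub, transpose_mul, transpose_mul, hABt, transpose_transpose, hA]
    noncomm_ring
  have hXv : X *ᵥ V A = 0 := by
    rw [hX, sub_mulVec, hAv, ← mulVec_mulVec, ← mulVec_mulVec, hUv, hABv, mulVec_zero, sub_zero]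
  have hvX : V A ᵥ* X = 0 := by
    rw [← mulVec_transpose, hXt, neg_mulVec, hXv, neg_zero]
  have hXm : ∀ i j, X i j ∈ maximalIdeal R ^ L := by
    have hXe : X = B + (of C)ᵀ * ((A + B) * U) + (A + B) * of C := by
      rw [hX, hU, transpose_add, transpose_one]
      noncomm_ring
    have hCL : ∀ i j, of C i j ∈ maximalIdeal R ^ L := fun i j =>
      Ideal.pow_le_pow_right (Nat.le_succ L) (hCm i j)
    intro i j
    rw [hXe]
    exact add_mem (add_mem (Ideal.pow_le_pow_right (by lia) (hBm i j))
      (mul_apply_mem (fun i j => hCL j i) _ i j)) (mul_apply_mem' hCL _ i j)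
  obtain ⟨Y, hY⟩ := hL X hXv hvX hXm
  have h1 := MatrixCongruent.add_of_eq_mul_mul h2 hA hAm hXt hY
  have h2 : MatrixCongruent (A + B) (A + X) :=
    ⟨Uᵀ, (isUnit_transpose U).2 hUu, by rw [transpose_transpose, hX]; abel⟩
  exact h1.trans h2.symm

end Determinacy

/-- The antisymmetric tridiagonal matrix with entries `1` above and `-1` below the diagonal. -/
def tridiagonal (R : Type*) [CommRing R] (n : ℕ) : Matrix (Fin n) (Fin n) R :=
  of fun i j => if (j : ℕ) = i + 1 then 1 else if (i : ℕ) = j + 1 then -1 else 0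

theorem tridiagonal_transpose (R : Type*) [CommRing R] (n : ℕ) :
    (tridiagonal R n)ᵀ = -tridiagonal R n := by
  ext i j
  simp only [tridiagonal, transpose_apply, of_apply, Matrix.neg_apply]
  split_ifs <;> first | lia | simp

theorem det_submatrix_tridiagonal (R : Type*) [CommRing R] (n : ℕ) :
    ((tridiagonal R (n + 1)).submatrix (Fin.last n).succAbove (Fin.succAbove 0)).det = 1 := by
  rw [det_of_isLowerTriangular]
  · simp [tridiagonal]
  · intro i j hij
    have hij : (i : ℕ) < j := hij
    simp only [tridiagonal, submatrix_apply, of_apply, Fin.succAbove_last, Fin.succAbove_zero,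
      Fin.val_castSucc, Fin.val_succ]
    split_ifs <;> lia

theorem adjugate_mul_mul_transpose_mem {R : Type*} [CommRing R] {n : ℕ} {I : Ideal R}
    {A : Matrix (Fin (n + 1)) (Fin (n + 1)) R} (hI : fittingIdeal n A ≤ I)
    (U : Matrix (Fin (n + 1)) (Fin (n + 1)) R) (i j : Fin (n + 1)) :
    (U * A * Uᵀ).adjugate i j ∈ I := by
  rw [adjugate_mul_distrib, adjugate_mul_distrib]
  exact mul_apply_mem' (mul_apply_mem (fun i j => hI (adjugate_mem_fittingIdeal A i j)) _) _ i j

theorem exists_pow_maximalIdeal_le_fittingIdeal {R : Type*} [CommRing R] [IsNoetherianRing R]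
    [IsLocalRing R] (h0 : ∀ p : Ideal R, p.IsPrime → CharZero (R ⧸ p)) {n : ℕ}
    {A : Matrix (Fin (n + 1)) (Fin (n + 1)) R} {K : ℕ}
    (hK : ∀ B : Matrix (Fin (n + 1)) (Fin (n + 1)) R, Bᵀ = -B →
      (∀ i j, B i j ∈ maximalIdeal R ^ (K + 1)) → MatrixCongruent A (A + B)) :
    ∃ N, maximalIdeal R ^ N ≤ fittingIdeal n A := by
  refine Ideal.exists_pow_le_of_le_radical_of_fg ?_ (IsNoetherian.noetherian _)
  rw [Ideal.radical_eq_sInf]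
  refine le_sInf fun p ⟨hI, hp⟩ x hx => ?_
  by_contra hxp
  have := h0 p hp
  set t := x ^ (K + 1) with ht
  have htp : Ideal.Quotient.mk p t ≠ 0 := fun h =>
    hxp (hp.mem_of_pow_mem _ (Ideal.Quotient.eq_zero_iff_mem.1 h))
  set T := tridiagonal R (n + 1) with hT
  let π := Ideal.Quotient.mk p
  let s (M : Matrix (Fin (n + 1)) (Fin (n + 1)) R) : Matrix (Fin n) (Fin n) R :=
    M.submatrix (Fin.last n).succAbove (Fin.succAbove 0)
  let q : Polynomial (R ⧸ p) := ((Polynomial.X : Polynomial (R ⧸ p)) •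
    (π.mapMatrix (s T)).map Polynomial.C + (π.mapMatrix (s A)).map Polynomial.C).det
  have hq : q ≠ 0 := fun h => by
    have h1 := Polynomial.coeff_det_X_add_C_card (π.mapMatrix (s T)) (π.mapMatrix (s A))
    rw [← RingHom.map_det, det_submatrix_tridiagonal, map_one] at h1
    change q.coeff _ = 1 at h1
    rw [h, Polynomial.coeff_zero] at h1
    exact zero_ne_one h1
  have hroot : ∀ c : ℕ, q.IsRoot (c * π t) := fun c => by
    have hB := hK ((c * t) • T)
      (by rw [transpose_smul, hT, tridiagonal_transpose, smul_neg])
      (fun i j => by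
        rw [Matrix.smul_apply, smul_eq_mul]
        exact Ideal.mul_mem_right _ _ (Ideal.mul_mem_left _ _ (Ideal.pow_mem_pow hx _)))
    obtain ⟨U, -, hU⟩ := hB
    have hadj := adjugate_mul_mul_transpose_mem hI U 0 (Fin.last n)
    rw [← hU, adjugate_fin_succ_eq_det_submatrix] at hadj
    have hdet : (s (A + (c * t) • T)).det ∈ p :=
      (Ideal.unit_mul_mem_iff_mem _ ((isUnit_neg_one).pow _)).1 hadj
    rw [← Ideal.Quotient.eq_zero_iff_mem, RingHom.map_det] at hdet
    rw [Polynomial.IsRoot, ← Polynomial.coe_evalRingHom, RingHom.map_det, ← hdet]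
    congr 1
    ext i j
    simp [s, π]
    ring
  refine hq (Polynomial.eq_zero_of_infinite_isRoot q (Set.Infinite.mono ?_
    (Set.infinite_range_of_injective (f := fun c : ℕ => (c : R ⧸ p) * π t) fun a b hab => ?_)))
  · rintro _ ⟨c, rfl⟩; exact hroot c
  · exact Nat.cast_injective (mul_right_cancel₀ htp hab)

end

/-- For `m ≥ 2`, an antisymmetric matrix `A ∈ Mat(m,m;𝔪)` is
finitely-`G_congr`-determined inside antisymmetric matrices iff
`𝔪^N ⊆ I_{m-1}(A)` for some `N`. -/
theorem finite_Gcongr_determined_antisymmetric_iff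
    {k R : Type*} [Field k] [CharZero k] [CommRing R] [Algebra k R]
    [IsNoetherianRing R] [IsLocalRing R]
    {m : ℕ} (hm : 2 ≤ m)
    (A : Matrix (Fin m) (Fin m) R) (hanti : A.transpose = -A)
    (hA : ∀ i j, A i j ∈ maximalIdeal R) :
    (∃ k₀ : ℕ, ∀ B : Matrix (Fin m) (Fin m) R,
        B.transpose = -B →
        (∀ i j, B i j ∈ (maximalIdeal R) ^ (k₀ + 1)) →
        ∃ U : Matrix (Fin m) (Fin m) R,
          IsUnit U ∧ A + B = U * A * U.transpose) ↔
    (∃ N : ℕ, (maximalIdeal R) ^ N ≤ fittingIdeal (m - 1) A) := by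
  obtain ⟨n, rfl⟩ : ∃ n, m = n + 1 := ⟨m - 1, by lia⟩
  have h2 : IsUnit (2 : R) := by
    have h := (two_ne_zero (α := k)).isUnit.map (algebraMap k R)
    rwa [map_ofNat] at h
  constructor
  · rintro ⟨K, hK⟩
    refine exists_pow_maximalIdeal_le_fittingIdeal (fun p hp => ?_) hK
    exact charZero_of_injective_algebraMap (algebraMap k (R ⧸ p)).injective
  · rintro ⟨N, hN⟩
    rcases Nat.even_or_odd n with hn | hn
    · exact exists_congruent_of_even h2 hn hanti hA hN
    · exact exists_congruent_of_odd h2 hn hanti hA hN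
end

section
/- Let k be a field of characteristic zero and (R,𝔪) a henselian Noetherian local k-algebra with dim R = 1, and let A ∈ Mat(m,m;𝔪) be upper triangular. Then A is finitely-𝒢^{up}_{lr}-determined inside upper triangular matrices if and only if A is finitely-G^{up}_{lr}-determined inside upper triangular matrices. -/
open IsLocalRing

/-- In a Noetherian local ring of dimension at most one, every element can be perturbed by an
element of any given power of the maximal ideal so that no other prime contains it. -/
theorem exists_mem_maximalIdeal_pow_forall_isPrime_eq {R : Type*} [CommRing R]
    [IsNoetherianRing R] [IsLocalRing R] [Ring.KrullDimLE 1 R] (a : R) (n : ℕ) :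
    ∃ b ∈ maximalIdeal R ^ n, ∀ P : Ideal R, P.IsPrime → a + b ∈ P → P = maximalIdeal R := by
  set S : Set (Ideal R) := minimalPrimes R \ {maximalIdeal R}
  have hS : S.Finite := (minimalPrimes.finite_of_isNoetherianRing R).sdiff
  obtain ⟨t, htm, ht⟩ : ∃ t ∈ maximalIdeal R, ∀ P ∈ S, t ∉ P := by
    by_contra! h
    obtain ⟨P, hP, hle⟩ := ((maximalIdeal R).subset_union_prime_finite hS (f := id) 0 0
      fun _ hP _ _ ↦ hP.1.1.1).1 fun t ht ↦ by
        obtain ⟨P, hP, htP⟩ := h t ht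
        exact Set.mem_biUnion hP htP
    exact hP.2 (((maximalIdeal.isMaximal R).eq_of_le hP.1.1.1.ne_top hle).symm)
  by_contra! h
  have hbad (j : ℕ) : ∃ P ∈ S, a + t ^ (n + j) ∈ P := by
    obtain ⟨P, hP, hmem, hne⟩ := h (t ^ (n + j))
      (Ideal.pow_le_pow_right (Nat.le_add_right n j) (Ideal.pow_mem_pow htm _))
    refine ⟨P, ⟨?_, hne⟩, hmem⟩
    exact (Ring.krullDimLE_one_iff.mp ‹_› P hP).resolve_right fun hmax ↦
      hne (IsLocalRing.eq_maximalIdeal hmax)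
  choose P hPS hP using hbad
  obtain ⟨i, -, j, -, hij, hPij⟩ := Set.infinite_univ.exists_lt_map_eq_of_mapsTo
    (fun j _ ↦ hPS j : Set.MapsTo P Set.univ S) hS
  have hprime : (P i).IsPrime := (hPS i).1.1.1
  have hdiff : t ^ (n + i) * (1 - t ^ (j - i)) ∈ P i := by
    have hsub := (P i).sub_mem (hP i) (hPij ▸ hP j)
    have hexp : n + j = n + i + (j - i) := by lia
    rw [hexp, pow_add t (n + i)] at hsub
    convert hsub using 1
    ring
  rcases hprime.mem_or_mem hdiff with hmem | hmem
  · exact ht _ (hPS i) (hprime.mem_of_pow_mem _ hmem)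
  · refine hprime.ne_top (Ideal.eq_top_of_isUnit_mem _ hmem ?_)
    have hnon : t ^ (j - i) ∈ nonunits R :=
      (maximalIdeal R).pow_mem_of_mem htm _ (Nat.sub_pos_of_lt hij)
    exact isUnit_one_sub_self_of_mem_nonunits _ hnon

/-- A matrix has a polynomial in itself as a right quasi-inverse, with product `± det`. -/
theorem Matrix.exists_mem_adjoin_mul_eq_det_smul {R n : Type*} [CommRing R] [Fintype n]
    [DecidableEq n] (A : Matrix n n R) :
    ∃ C ∈ Algebra.adjoin R {A}, A * C = A.det • (1 : Matrix n n R) := by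
  refine ⟨(-(-1) ^ Fintype.card n : R) • Polynomial.aeval A A.charpoly.divX,
    Subalgebra.smul_mem _ (Polynomial.aeval_mem_adjoin_singleton R A) _, ?_⟩
  have h := A.aeval_self_charpoly
  rw [← A.charpoly.X_mul_divX_add, map_add, map_mul, Polynomial.aeval_X, Polynomial.aeval_C,
    add_eq_zero_iff_eq_neg] at h
  rw [mul_smul_comm, h, A.det_eq_sign_charpoly_coeff, Algebra.algebraMap_eq_smul_one, smul_neg,
    smul_smul, neg_mul, neg_smul, neg_neg]

/-- The product of upper triangular matrices has the product of the diagonals as diagonal. -/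
theorem Matrix.BlockTriangular.mul_apply_diag {R n : Type*} [CommRing R] [Fintype n]
    [LinearOrder n] {M N : Matrix n n R} (hM : M.BlockTriangular id) (hN : N.BlockTriangular id)
    (i : n) : (M * N) i i = M i i * N i i := by
  rw [Matrix.mul_apply]
  refine Finset.sum_eq_single i (fun j _ hj ↦ ?_) (by simp)
  rcases lt_or_gt_of_ne hj with h | h
  · rw [hM h, zero_mul]
  · rw [hN h, mul_zero]

/-- If every prime containing some diagonal entry of an upper triangular matrix `A` is maximal,
then `A` is finitely determined under right multiplication by invertible upper triangular
matrices. -/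
theorem Matrix.BlockTriangular.exists_forall_add_eq_mul {R n : Type*} [CommRing R]
    [IsNoetherianRing R] [IsLocalRing R] [Fintype n] [LinearOrder n] {A : Matrix n n R}
    (hA : A.BlockTriangular id)
    (hprime : ∀ i, ∀ P : Ideal R, P.IsPrime → A i i ∈ P → P = maximalIdeal R) :
    ∃ k₀ : ℕ, ∀ B : Matrix n n R, B.BlockTriangular id →
      (∀ i j, B i j ∈ maximalIdeal R ^ (k₀ + 1)) →
      ∃ V : Matrix n n R, V.BlockTriangular id ∧ IsUnit V ∧ A + B = A * V := by
  obtain ⟨C, hC, hAC⟩ := A.exists_mem_adjoin_mul_eq_det_smul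
  replace hC : C.BlockTriangular id := by
    have hle : Algebra.adjoin R {A} ≤ Matrix.blockTriangularSubalgebra R (R := R) (id : n → n) :=
      Algebra.adjoin_le (by simpa using hA)
    exact hle hC
  have hrad : maximalIdeal R ≤ (Ideal.span {A.det}).radical := by
    rw [Ideal.radical_eq_sInf]
    refine le_sInf fun P ⟨hle, hP⟩ ↦ ?_
    have hdet : A.det ∈ P := hle (Ideal.mem_span_singleton_self _)
    rw [Matrix.det_of_isUpperTriangular hA] at hdet
    obtain ⟨i, -, hi⟩ := hP.prod_mem_iff.mp hdet
    exact (hprime i P hP hi).ge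
  obtain ⟨k₀, hk⟩ := Ideal.exists_pow_le_of_le_radical_of_fg hrad (IsNoetherian.noetherian _)
  have hdiv (b : R) (hb : b ∈ maximalIdeal R ^ (k₀ + 1)) :
      ∃ c ∈ maximalIdeal R, A.det * c = b := by
    rw [← Ideal.mem_span_singleton_mul]
    rw [pow_succ] at hb
    exact Ideal.mul_mono_left hk hb
  refine ⟨k₀, fun B hB hBm ↦ ?_⟩
  choose c hcm hc using fun i j ↦ hdiv (B i j) (hBm i j)
  set D : Matrix n n R := Matrix.of fun i j ↦ if j < i then 0 else c i j
  have hD : D.BlockTriangular id := fun i j (hij : j < i) ↦ by simp [D, hij]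
  have hBD : A.det • D = B := by
    ext i j
    by_cases hij : j < i
    · simp [D, hij, hB hij]
    · simp [D, hij, hc]
  have hDm (i : n) : D i i ∈ maximalIdeal R := by simpa [D] using hcm i i
  have hV : (1 + C * D).BlockTriangular id := Matrix.blockTriangular_one.add (hC.mul hD)
  refine ⟨1 + C * D, hV, ?_, ?_⟩
  · rw [Matrix.isUnit_iff_isUnit_det, Matrix.det_of_isUpperTriangular hV, IsUnit.prod_univ_iff]
    intro i
    rw [Matrix.add_apply, Matrix.one_apply_eq, hC.mul_apply_diag hD, ← sub_neg_eq_add]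
    refine isUnit_one_sub_self_of_mem_nonunits _ ?_
    exact (maximalIdeal R).neg_mem ((maximalIdeal R).mul_mem_left _ (hDm i))
  · rw [mul_add, mul_one, ← mul_assoc, hAC, smul_mul_assoc, one_mul, hBD]

/-- Over a henselian Noetherian local `k`-algebra with `dim R = 1`, an
upper triangular `A ∈ Mat(m,m;𝔪)` is finitely-`𝒢^{up}_{lr}`-determined inside upper
triangular matrices iff it is finitely-`G^{up}_{lr}`-determined there. -/
theorem finite_cGup_lr_determined_iff_finite_Gup_lr_determined
    {k R : Type*} [Field k] [CharZero k] [CommRing R] [Algebra k R]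
    [IsNoetherianRing R] [IsLocalRing R] [HenselianLocalRing R]
    (hdim : ringKrullDim R = 1)
    {m : ℕ}
    (A : Matrix (Fin m) (Fin m) R)
    (hup : ∀ i j : Fin m, j < i → A i j = 0)
    (hA : ∀ i j, A i j ∈ maximalIdeal R) :
    (∃ k₀ : ℕ, ∀ B : Matrix (Fin m) (Fin m) R,
        (∀ i j : Fin m, j < i → B i j = 0) →
        (∀ i j, B i j ∈ (maximalIdeal R) ^ (k₀ + 1)) →
        ∃ (U V : Matrix (Fin m) (Fin m) R) (φ : R ≃ₐ[k] R),
          (∀ i j : Fin m, j < i → U i j = 0) ∧ (∀ i j : Fin m, j < i → V i j = 0) ∧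
          IsUnit U ∧ IsUnit V ∧ A + B = U * (A.map φ) * V) ↔
    (∃ k₀ : ℕ, ∀ B : Matrix (Fin m) (Fin m) R,
        (∀ i j : Fin m, j < i → B i j = 0) →
        (∀ i j, B i j ∈ (maximalIdeal R) ^ (k₀ + 1)) →
        ∃ (U V : Matrix (Fin m) (Fin m) R),
          (∀ i j : Fin m, j < i → U i j = 0) ∧ (∀ i j : Fin m, j < i → V i j = 0) ∧
          IsUnit U ∧ IsUnit V ∧ A + B = U * A * V) := by
  have : Ring.KrullDimLE 1 R := Ring.krullDimLE_iff.mpr hdim.le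
  have hAup : A.BlockTriangular id := fun i j hij ↦ hup i j hij
  constructor
  · rintro ⟨k₀, hk⟩
    choose b hbm hb using fun i ↦
      exists_mem_maximalIdeal_pow_forall_isPrime_eq (A i i) (k₀ + 1)
    obtain ⟨U, V, φ, hU, hV, -, -, h⟩ := hk (Matrix.diagonal b)
      (fun i j hij ↦ Matrix.diagonal_apply_ne _ hij.ne') fun i j ↦ by
        rcases eq_or_ne i j with rfl | hij
        · simpa using hbm i
        · simp [hij]
    replace hU : U.BlockTriangular id := fun i j hij ↦ hU i j hij
    replace hV : V.BlockTriangular id := fun i j hij ↦ hV i j hij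
    have hφA : (A.map φ).BlockTriangular id := hAup.map φ
    have hprime (i : Fin m) (P : Ideal R) (hP : P.IsPrime) (hAP : A i i ∈ P) :
        P = maximalIdeal R := by
      have hmax : P.comap φ.symm = maximalIdeal R := by
        refine hb i _ (hP.comap φ.symm) ?_
        have hii := congrFun₂ h i i
        rw [(hU.mul hφA).mul_apply_diag hV, hU.mul_apply_diag hφA, Matrix.add_apply,
          Matrix.diagonal_apply_eq, Matrix.map_apply] at hii
        rw [hii]
        refine Ideal.mul_mem_right _ _ (Ideal.mul_mem_left _ _ ?_)
        simpa [Ideal.mem_comap] using hAP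
      refine eq_of_le_of_not_lt (le_maximalIdeal hP.ne_top) fun hlt ↦ ?_
      obtain ⟨x, hx, hxP⟩ := SetLike.exists_of_lt hlt
      have hφx : φ x ∈ maximalIdeal R := by
        rw [mem_maximalIdeal, mem_nonunits_iff] at hx ⊢
        simpa using hx
      rw [← hmax] at hφx
      exact hxP (by simpa [Ideal.mem_comap] using hφx)
    obtain ⟨k₁, hk₁⟩ := hAup.exists_forall_add_eq_mul hprime
    refine ⟨k₁, fun B hB hBm ↦ ?_⟩
    obtain ⟨W, hW, hWu, hAB⟩ := hk₁ B (fun i j hij ↦ hB i j hij) hBm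
    exact ⟨1, W, fun i j hij ↦ Matrix.one_apply_ne hij.ne', fun i j hij ↦ hW hij, isUnit_one,
      hWu, by rwa [one_mul]⟩
  · rintro ⟨k₀, hk⟩
    refine ⟨k₀, fun B hB hBm ↦ ?_⟩
    obtain ⟨U, V, hU, hV, hUu, hVu, h⟩ := hk B hB hBm
    refine ⟨U, V, AlgEquiv.refl, hU, hV, hUu, hVu, ?_⟩
    rw [h]
    congr 2
end
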